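/- Let (W,S) be the affine Coxeter system of type Ẽ_8: S = {0,1,...,8} with m(1,3) = m(3,4) = m(4,5) = m(5,6) = m(6,7) = m(7,8) = m(2,4) = m(0,8) = 3 and all other pairs commuting (m = 2). Then the homology of the weighted complex C_*(W) is: H_0 ≅ R/(Φ_2); H_1 = H_2 = H_3 = 0; H_4 ≅ R/(Φ_4); H_5 = 0; H_6 ≅ R/(Φ_5) ⊕ R/(Φ_8); H_7 ≅ (R/(Φ_2))² ⊕ R/(Φ_3) ⊕ R/(Φ_4) ⊕ R/(Φ_5) ⊕ R/(Φ_8) ⊕ R/(Φ_9) ⊕ R/(Φ_14); H_8 ≅ R; and H_k = 0 for all k ≥ 9. -/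

import Mathlib

open Polynomial CoxeterSystem

set_option synthInstance.maxHeartbeats 1000000
set_option maxHeartbeats 1000000

noncomputable section

/-- The ring `R = ℚ[q,q⁻¹]` of Laurent polynomials over `ℚ`. -/
abbrev R : Type := LaurentPolynomial ℚ

/-- The image of the `d`-th cyclotomic polynomial `Φ_d` in `R`. -/
def cyc (d : ℕ) : R := Polynomial.toLaurent (Polynomial.cyclotomic d ℚ)

/-- The `R`-module `R/(Φ_d)`. -/
abbrev CycQuot (d : ℕ) := R ⧸ Ideal.span {cyc d}

variable {B : Type*} [Fintype B] [LinearOrder B] {W : Type*} [Group W]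
  {M : CoxeterMatrix B} (cs : CoxeterSystem M W)

/-- The standard parabolic subgroup `W_σ` generated by `σ ⊆ S`. -/
def parabolic (σ : Finset B) : Subgroup W := Subgroup.closure (cs.simple '' σ)

/-- The Poincaré polynomial `W_σ(q) = Σ_{w ∈ W_σ} q^{ℓ(w)}` of the standard parabolic
subgroup `W_σ` (defined to be `0` if `W_σ` is infinite). -/
def poin (σ : Finset B) : ℚ[X] :=
  letI := Classical.dec ((parabolic cs σ : Set W).Finite)
  if h : (parabolic cs σ : Set W).Finite then ∑ w ∈ h.toFinset, X ^ cs.length w else 0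

/-- The set of simplices `σ ∈ K_W` with `|σ| = k`, i.e. the subsets of `S` of
cardinality `k` generating a finite standard parabolic subgroup. -/
abbrev KW (k : ℕ) := {σ : Finset B // σ.card = k ∧ (parabolic cs σ : Set W).Finite}

noncomputable instance (k : ℕ) : Fintype (KW cs k) := Fintype.ofFinite _

/-- The coefficient of `e_τ` in `∂ e_σ`: it is
`(−1)^{#{t ∈ σ : t < s}} · W_σ(q)/W_{σ∖{s}}(q)` if `τ = σ ∖ {s}` for some `s ∈ σ`,
and `0` otherwise. -/
def bcoeff (σ τ : Finset B) : R :=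
  ∑ s ∈ σ, if τ = σ.erase s then
      (-1 : R) ^ (σ.filter (fun t => t < s)).card *
        Polynomial.toLaurent (poin cs σ / poin cs τ)
    else 0

/-- The boundary map `∂ : C_{k+1} → C_k` of the weighted complex `C_*(W)`, where
`C_k = ⊕_{σ ∈ K_W, |σ| = k} R·e_σ`. -/
def bdry (k : ℕ) : (KW cs (k + 1) → R) →ₗ[R] (KW cs k → R) :=
  Matrix.mulVecLin (Matrix.of fun (τ : KW cs k) (σ : KW cs (k + 1)) => bcoeff cs σ.1 τ.1)

/-- The submodule of cycles in degree `k` of the weighted complex. -/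
def cycles : (k : ℕ) → Submodule R (KW cs k → R)
  | 0 => ⊤
  | (k + 1) => LinearMap.ker (bdry cs k)

/-- The `k`-th homology `H_k(C_*(W))` of the weighted complex: cycles modulo boundaries. -/
abbrev Hgy (k : ℕ) :=
  cycles cs k ⧸ Submodule.comap (cycles cs k).subtype (LinearMap.range (bdry cs k))

end

set_option linter.unusedSectionVars false

noncomputable section

namespace SimplyLaced

variable {B : Type*} [Fintype B] [LinearOrder B] {W : Type*} [Group W] {M : CoxeterMatrix B}

/-- A Coxeter matrix is simply laced if all its off-diagonal entries are `2` or `3`. -/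
def IsSimplyLaced (M : CoxeterMatrix B) : Prop := ∀ i j, i ≠ j → M.M i j = 2 ∨ M.M i j = 3

/-- The Cartan matrix of a simply laced Coxeter matrix. -/
def cartan (M : CoxeterMatrix B) (i j : B) : ℤ :=
  if i = j then 2 else if M.M i j = 3 then -1 else 0

lemma cartan_symm (i j : B) : cartan M i j = cartan M j i := by
  simp [cartan, eq_comm, M.symmetric i j]

lemma cartan_self (i : B) : cartan M i i = 2 := by simp [cartan]

/-- The pairing with the `i`-th simple coroot. -/
def coroot (M : CoxeterMatrix B) (i : B) : (B → ℤ) →ₗ[ℤ] ℤ :=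
  ∑ j, cartan M i j • LinearMap.proj j

/-- The `i`-th simple root. -/
def root (i : B) : B → ℤ := Pi.single i 1

lemma coroot_apply (i : B) (v : B → ℤ) : coroot M i v = ∑ j, cartan M i j * v j := by
  simp [coroot]

lemma coroot_root (i j : B) : coroot M i (root j) = cartan M i j := by
  simp [coroot_apply, root, Pi.single_apply]

/-- The `i`-th simple reflection of the geometric representation. -/
def refl (M : CoxeterMatrix B) (i : B) : Module.End ℤ (B → ℤ) :=
  LinearMap.id - (coroot M i).smulRight (root i)

lemma refl_apply (i : B) (v : B → ℤ) : refl M i v = v - coroot M i v • root i := by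
  simp [refl]

lemma refl_root (i j : B) : refl M i (root j) = root j - cartan M i j • root i := by
  rw [refl_apply, coroot_root]

lemma refl_apply_of_ne {i k : B} (h : k ≠ i) (v : B → ℤ) : refl M i v k = v k := by
  simp [refl_apply, root, h]

lemma isLiftable_refl (hM : IsSimplyLaced M) : M.IsLiftable (refl M) := by
  have sq : ∀ i, refl M i * refl M i = 1 := by
    intro i
    refine LinearMap.ext fun v => ?_
    simp only [Module.End.mul_apply, refl_apply, map_sub, map_smul, coroot_root, cartan_self,
      Module.End.one_apply]
    module
  intro i j
  rcases eq_or_ne i j with rfl | hij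
  · rw [sq, one_pow]
  have hc : M.M i j = 2 ∧ cartan M i j = 0 ∨ M.M i j = 3 ∧ cartan M i j = -1 := by
    rcases hM i j hij with h | h <;> simp [cartan, hij, h]
  have e : ∀ x : Module.End ℤ (B → ℤ), refl M i * (refl M i * x) = x := fun x => by
    rw [← mul_assoc, sq, one_mul]
  rcases hc with ⟨h, c⟩ | ⟨h, c⟩
  · rw [h, pow_two]
    have c' : cartan M j i = 0 := cartan_symm (M := M) i j ▸ c
    have : refl M i * refl M j = refl M j * refl M i := by
      refine LinearMap.ext fun v => ?_
      simp only [Module.End.mul_apply, refl_apply, map_sub, map_smul, coroot_root, c, c']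
      module
    rw [mul_assoc, ← mul_assoc (refl M j), ← this, mul_assoc, sq, mul_one, sq]
  · rw [h, pow_three]
    have c' : cartan M j i = -1 := cartan_symm (M := M) i j ▸ c
    have : refl M j * (refl M i * refl M j) = refl M i * (refl M j * refl M i) := by
      refine LinearMap.ext fun v => ?_
      simp only [Module.End.mul_apply, refl_apply, map_sub, map_smul, coroot_root, c, c',
        cartan_self]
      module
    calc _ = refl M i * ((refl M j * (refl M i * refl M j)) * (refl M i * refl M j)) := by
          simp only [mul_assoc]
      _ = _ := by
          rw [this]
          simp only [mul_assoc, e]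
          exact sq j

variable (cs : CoxeterSystem M W)

/-- The geometric representation of a simply laced Coxeter group, on the root lattice. -/
def rep (hM : IsSimplyLaced M) : W →* Module.End ℤ (B → ℤ) :=
  cs.lift ⟨refl M, isLiftable_refl hM⟩

variable {cs} (hM : IsSimplyLaced M)

lemma rep_simple (i : B) : rep cs hM (cs.simple i) = refl M i := cs.lift_apply_simple _ i

lemma rep_mul (w w' : W) (v : B → ℤ) : rep cs hM (w * w') v = rep cs hM w (rep cs hM w' v) := by
  rw [map_mul]; rfl

lemma rep_inv_apply (w : W) (v : B → ℤ) : rep cs hM w⁻¹ (rep cs hM w v) = v := by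
  rw [← rep_mul, inv_mul_cancel, map_one]; rfl

lemma rep_apply_inv (w : W) (v : B → ℤ) : rep cs hM w (rep cs hM w⁻¹ v) = v := by
  rw [← rep_mul, mul_inv_cancel, map_one]; rfl

lemma rep_injective (w : W) : Function.Injective (rep cs hM w) :=
  Function.LeftInverse.injective (rep_inv_apply hM w)

lemma rep_mul_simple_root (w : W) (i : B) :
    rep cs hM (w * cs.simple i) (root i) = - rep cs hM w (root i) := by
  rw [rep_mul, rep_simple, refl_root, cartan_self, ← map_neg]
  congr 1; module

lemma root_ne_zero (i : B) : root i ≠ 0 := by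
  simp [root]

lemma rep_root_nonneg (w : W) (s : B) (h : ¬ cs.IsRightDescent w s) :
    0 ≤ rep cs hM w (root s) := by
  induction hn : cs.length w using Nat.strong_induction_on generalizing w s with
  | _ n ih =>
  subst hn
  rcases eq_or_ne w 1 with rfl | hw
  · rw [map_one]
    simp [root]
  obtain ⟨t, ht⟩ := cs.exists_rightDescent_of_ne_one hw
  have hst : s ≠ t := by rintro rfl; exact h ht
  rw [cs.not_isRightDescent_iff] at h
  have hv := cs.isRightDescent_iff.1 ht
  have wv : w * cs.simple t * cs.simple t = w := cs.simple_mul_simple_cancel_right t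
  have rw1 : rep cs hM w (root s) = rep cs hM (w * cs.simple t) (root s - cartan M t s • root t) := by
    conv_lhs => rw [← wv, rep_mul, rep_simple, refl_root]
  have cs1 : M.M t s = 2 ∧ cartan M t s = 0 ∨ M.M t s = 3 ∧ cartan M t s = -1 := by
    rcases hM t s hst.symm with h | h <;> simp [cartan, hst.symm, h]
  have hvt : ¬ cs.IsRightDescent (w * cs.simple t) t := by
    rw [cs.not_isRightDescent_iff, wv]; omega
  rcases cs1 with ⟨m, c⟩ | ⟨m, c⟩
  · have comm : cs.simple t * cs.simple s = cs.simple s * cs.simple t := by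
      have := cs.simple_mul_simple_pow t s
      rw [m, pow_two, mul_eq_one_iff_eq_inv, mul_inv_rev, cs.inv_simple, cs.inv_simple] at this
      exact this
    rw [rw1, c, zero_smul, sub_zero]
    refine ih _ (by omega) _ s ?_ rfl
    intro hd
    have := cs.isRightDescent_iff.1 hd
    have e : w * cs.simple s = w * cs.simple t * cs.simple s * cs.simple t := by
      rw [mul_assoc _ (cs.simple s), ← comm, ← mul_assoc, wv]
    have := cs.length_mul_le (w * cs.simple t * cs.simple s) (cs.simple t)
    rw [← e, cs.length_simple] at this
    omega
  · by_cases hd : cs.IsRightDescent (w * cs.simple t) s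
    · have hu := cs.isRightDescent_iff.1 hd
      set u := w * cs.simple t * cs.simple s with hu_def
      have us : u * cs.simple s = w * cs.simple t := cs.simple_mul_simple_cancel_right s
      have c' : cartan M s t = -1 := cartan_symm (M := M) t s ▸ c
      have : rep cs hM w (root s) = rep cs hM u (root t) := by
        rw [rw1, ← us, rep_mul, rep_simple, map_sub, map_smul, refl_root, refl_root, c, c',
          cartan_self]
        congr 1; module
      rw [this]
      refine ih _ (by omega) _ t ?_ rfl
      intro hd2
      have h2 := cs.isRightDescent_iff.1 hd2
      have braid : cs.simple t * cs.simple s * cs.simple t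
          = cs.simple s * cs.simple t * cs.simple s := by
        have := cs.simple_mul_simple_pow t s
        have : cs.simple t * cs.simple s * cs.simple t *
            (cs.simple s * cs.simple t * cs.simple s) = 1 := by
          simpa [m, pow_three, mul_assoc] using this
        rw [mul_eq_one_iff_eq_inv] at this
        simpa [mul_assoc] using this
      have e : w * cs.simple s = u * cs.simple t * (cs.simple s * cs.simple t) := by
        have : w = u * cs.simple s * cs.simple t := by rw [us, wv]
        conv_lhs => rw [this]
        rw [mul_assoc, mul_assoc, ← mul_assoc (cs.simple s), ← braid]
        simp only [mul_assoc]
      have l1 := cs.length_mul_le (u * cs.simple t) (cs.simple s * cs.simple t)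
      have l2 := cs.length_mul_le (cs.simple s) (cs.simple t)
      rw [cs.length_simple, cs.length_simple] at l2
      rw [← e] at l1
      omega
    · have h1 := ih _ (by omega) _ s hd rfl
      have h2 := ih _ (by omega) _ t hvt rfl
      rw [rw1, c, neg_one_smul, sub_neg_eq_add, map_add]
      exact add_nonneg h1 h2

lemma rep_root_ne_zero (w : W) (s : B) : rep cs hM w (root s) ≠ 0 := fun h =>
  root_ne_zero s (rep_injective hM w (by rw [h, map_zero]))

lemma rep_root_nonpos (w : W) (s : B) (h : cs.IsRightDescent w s) :
    rep cs hM w (root s) ≤ 0 := by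
  have := rep_root_nonneg hM (w * cs.simple s) s (cs.isRightDescent_iff_not_isRightDescent_mul.1 h)
  rwa [rep_mul_simple_root, neg_nonneg] at this

lemma isRightDescent_iff_nonpos (w : W) (s : B) :
    cs.IsRightDescent w s ↔ rep cs hM w (root s) ≤ 0 := by
  refine ⟨rep_root_nonpos hM w s, fun h => ?_⟩
  by_contra hd
  exact rep_root_ne_zero hM w s (le_antisymm h (rep_root_nonneg hM w s hd))

lemma not_isRightDescent_iff_nonneg (w : W) (s : B) :
    ¬ cs.IsRightDescent w s ↔ 0 ≤ rep cs hM w (root s) := by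
  refine ⟨rep_root_nonneg hM w s, fun h hd => ?_⟩
  exact rep_root_ne_zero hM w s (le_antisymm (rep_root_nonpos hM w s hd) h)

lemma isLeftDescent_iff_nonpos (w : W) (s : B) :
    cs.IsLeftDescent w s ↔ rep cs hM w⁻¹ (root s) ≤ 0 := by
  rw [← cs.isRightDescent_inv_iff, isRightDescent_iff_nonpos]

lemma not_isLeftDescent_iff_nonneg (w : W) (s : B) :
    ¬ cs.IsLeftDescent w s ↔ 0 ≤ rep cs hM w⁻¹ (root s) := by
  rw [← cs.isRightDescent_inv_iff, not_isRightDescent_iff_nonneg]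

/-- A group with a nonzero nonnegative vector fixed by all simple reflections is infinite. -/
lemma infinite_of_fixed (hM : IsSimplyLaced M) (δ : B → ℤ) (hδ : 0 ≤ δ) (h0 : δ ≠ 0) (hfix : ∀ i, coroot M i δ = 0)
    (cs : CoxeterSystem M W) : Infinite W := by
  by_contra hinf
  rw [not_infinite_iff_finite] at hinf
  obtain ⟨w, hw⟩ := Finite.exists_max (fun w : W => cs.length w)
  have fix : ∀ w : W, rep cs hM w δ = δ := by
    intro w
    induction w using cs.simple_induction_left with
    | one => rw [map_one]; rfl
    | mul_simple_left w i h => rw [rep_mul, h, rep_simple, refl_apply, hfix, zero_smul, sub_zero]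
  have hneg : ∀ i, rep cs hM w (root i) ≤ 0 := fun i => by
    rw [← isRightDescent_iff_nonpos]
    have := hw (w * cs.simple i)
    have := cs.length_mul_simple_ne w i
    unfold CoxeterSystem.IsRightDescent
    omega
  have : δ = ∑ i, δ i • root i := by
    ext k; simp [root, Finset.sum_apply, Pi.single_apply]
  have h2 : δ ≤ 0 := by
    rw [← fix w, this, map_sum]
    refine Finset.sum_nonpos fun i _ => ?_
    rw [map_smul]
    exact smul_nonpos_of_nonneg_of_nonpos (hδ i) (hneg i)
  exact h0 (le_antisymm h2 hδ)

lemma rep_apply_of_notMem {τ : Finset B} {w : W} (hw : w ∈ parabolic cs τ) {k : B} (hk : k ∉ τ)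
    (v : B → ℤ) : rep cs hM w v k = v k := by
  induction hw using Subgroup.closure_induction generalizing v with
  | mem x hx =>
    obtain ⟨i, hi, rfl⟩ := hx
    rw [rep_simple, refl_apply_of_ne]
    rintro rfl
    exact hk hi
  | one => rw [map_one]; rfl
  | mul x y _ _ hx hy => rw [rep_mul, hx, hy]
  | inv x _ hx => rw [← hx (rep cs hM x⁻¹ v), rep_apply_inv]

lemma simple_mem_parabolic {τ : Finset B} {i : B} (hi : i ∈ τ) : cs.simple i ∈ parabolic cs τ :=
  Subgroup.subset_closure ⟨i, hi, rfl⟩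

include hM in
lemma mem_of_isRightDescent {τ : Finset B} {w : W} (hw : w ∈ parabolic cs τ) {j : B}
    (h : cs.IsRightDescent w j) : j ∈ τ := by
  by_contra hj
  have h1 := (isRightDescent_iff_nonpos hM w j).1 h j
  rw [rep_apply_of_notMem hM hw hj] at h1
  simp [root] at h1

lemma rep_nonneg {τ : Finset B} {u : W} (hu : ∀ t ∈ τ, 0 ≤ rep cs hM u (root t)) {x : B → ℤ}
    (hx : 0 ≤ x) (hxτ : ∀ k ∉ τ, x k = 0) : 0 ≤ rep cs hM u x := by
  have : x = ∑ i, x i • root i := by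
    ext k; simp [root, Finset.sum_apply, Pi.single_apply]
  rw [this, map_sum]
  refine Finset.sum_nonneg fun i _ => ?_
  by_cases hi : i ∈ τ
  · rw [map_smul]
    exact smul_nonneg (hx i) (hu i hi)
  · rw [hxτ i hi, zero_smul, map_zero]

lemma length_mul_of_nonneg {τ : Finset B} {u v : W} (hu : ∀ t ∈ τ, 0 ≤ rep cs hM u (root t))
    (hv : v ∈ parabolic cs τ) : cs.length (u * v) = cs.length u + cs.length v := by
  induction hn : cs.length v using Nat.strong_induction_on generalizing v with
  | _ n ih =>
  subst hn
  rcases eq_or_ne v 1 with rfl | hv1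
  · simp
  obtain ⟨t, ht⟩ := cs.exists_rightDescent_of_ne_one hv1
  have htτ := mem_of_isRightDescent hM hv ht
  have h1 := cs.isRightDescent_iff.1 ht
  have hv' : v * cs.simple t ∈ parabolic cs τ := mul_mem hv (simple_mem_parabolic htτ)
  have h2 := ih _ (by omega) hv' rfl
  have h3 : 0 ≤ rep cs hM (u * (v * cs.simple t)) (root t) := by
    rw [rep_mul]
    refine rep_nonneg hM hu ?_ fun k hk => ?_
    · exact (not_isRightDescent_iff_nonneg hM _ _).1
        (cs.isRightDescent_iff_not_isRightDescent_mul.1 ht)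
    · rw [rep_apply_of_notMem hM hv' hk]
      have : k ≠ t := by rintro rfl; exact hk htτ
      simp [root, this]
  rw [← not_isRightDescent_iff_nonneg, cs.not_isRightDescent_iff] at h3
  have e : u * (v * cs.simple t) * cs.simple t = u * v := by
    rw [mul_assoc, cs.simple_mul_simple_cancel_right]
  rw [e] at h3
  omega

lemma exists_mul_eq {τ σ : Finset B} (hτ : τ ⊆ σ) {w : W} (hw : w ∈ parabolic cs σ) :
    ∃ u ∈ parabolic cs σ, ∃ v ∈ parabolic cs τ, (∀ t ∈ τ, 0 ≤ rep cs hM u (root t)) ∧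
      w = u * v := by
  induction hn : cs.length w using Nat.strong_induction_on generalizing w with
  | _ n ih =>
  subst hn
  by_cases h : ∃ t ∈ τ, cs.IsRightDescent w t
  · obtain ⟨t, ht, hd⟩ := h
    have h1 := cs.isRightDescent_iff.1 hd
    obtain ⟨u, hu, v, hv, h2, h3⟩ := ih _ (by omega)
      (mul_mem hw (simple_mem_parabolic (hτ ht))) rfl
    refine ⟨u, hu, v * cs.simple t, mul_mem hv (simple_mem_parabolic ht), h2, ?_⟩
    rw [← mul_assoc, ← h3, cs.simple_mul_simple_cancel_right]
  · push Not at h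
    exact ⟨w, hw, 1, one_mem _, fun t ht => (not_isRightDescent_iff_nonneg hM _ _).1 (h t ht),
      (mul_one w).symm⟩

lemma eq_of_mul_eq {τ : Finset B} {u u' v v' : W} (hu : ∀ t ∈ τ, 0 ≤ rep cs hM u (root t))
    (hu' : ∀ t ∈ τ, 0 ≤ rep cs hM u' (root t)) (hv : v ∈ parabolic cs τ)
    (hv' : v' ∈ parabolic cs τ) (h : u * v = u' * v') : u = u' ∧ v = v' := by
  have h1 := length_mul_of_nonneg hM hu (mul_mem hv (inv_mem hv'))
  have h2 := length_mul_of_nonneg hM hu' (mul_mem hv' (inv_mem hv))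
  rw [← mul_assoc, h, mul_inv_cancel_right] at h1
  rw [← mul_assoc, ← h, mul_inv_cancel_right] at h2
  have h3 : v * v'⁻¹ = 1 := by rw [← cs.length_eq_zero_iff]; omega
  have h4 : v = v' := mul_inv_eq_one.1 h3
  subst h4
  exact ⟨mul_right_cancel h, rfl⟩

variable (cs) in
/-- The minimal coset representatives of `W_σ / W_{σ∖{s}}`. -/
def minReps (σ : Finset B) (s : B) : Set W :=
  {u | u ∈ parabolic cs σ ∧ ∀ t ∈ σ.erase s, 0 ≤ rep cs hM u (root t)}

variable (cs) in
/-- The coordinates of the image under `u` of the fundamental weight of `s`. -/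
def state (s : B) (u : W) : B → ℤ := fun j => rep cs hM u⁻¹ (root j) s

lemma state_one (s : B) : state cs hM s 1 = root s := by
  ext j
  simp [state, root, Pi.single_apply, eq_comm]

/-- The action of the `j`-th simple reflection on weights. -/
def step (M : CoxeterMatrix B) (x : B → ℤ) (j : B) : B → ℤ := fun i => x i - cartan M j i * x j

lemma state_simple_mul (s j : B) (u : W) :
    state cs hM s (cs.simple j * u) = step M (state cs hM s u) j := by
  ext i
  simp only [state, step, mul_inv_rev, cs.inv_simple]
  rw [rep_mul, rep_simple, refl_root, map_sub, map_smul]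
  simp

lemma isLeftDescent_of_state_neg {s j : B} {u : W} (h : state cs hM s u j < 0) :
    cs.IsLeftDescent u j := by
  by_contra hd
  exact absurd ((not_isLeftDescent_iff_nonneg hM u j).1 hd s) (not_le.2 h)

lemma not_isLeftDescent_of_state_pos {s j : B} {u : W} (h : 0 < state cs hM s u j) :
    ¬ cs.IsLeftDescent u j := fun hd =>
  absurd ((isLeftDescent_iff_nonpos hM u j).1 hd s) (not_le.2 h)

lemma exists_state_neg {σ : Finset B} {s : B} {u : W} (hu : u ∈ minReps cs hM σ s) (h1 : u ≠ 1) :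
    ∃ j ∈ σ, state cs hM s u j < 0 := by
  obtain ⟨j, hj⟩ := cs.exists_leftDescent_of_ne_one h1
  have hjσ : j ∈ σ := mem_of_isRightDescent hM (inv_mem hu.1) (cs.isRightDescent_inv_iff.2 hj)
  have hn := (isLeftDescent_iff_nonpos hM u j).1 hj
  refine ⟨j, hjσ, lt_of_le_of_ne (hn s) fun h0 => ?_⟩
  have h2 : 0 ≤ rep cs hM u (- rep cs hM u⁻¹ (root j)) := by
    refine rep_nonneg hM hu.2 (neg_nonneg.2 hn) fun k hk => ?_
    rw [Pi.neg_apply, neg_eq_zero]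
    rcases eq_or_ne k s with rfl | hks
    · exact h0
    · have hkσ : k ∉ σ := fun h => hk (Finset.mem_erase.2 ⟨hks, h⟩)
      rw [rep_apply_of_notMem hM (inv_mem hu.1) hkσ]
      have : k ≠ j := by rintro rfl; exact hkσ hjσ
      simp [root, this]
  rw [map_neg, rep_apply_inv] at h2
  have := h2 j
  simp [root] at this

lemma simple_mul_mem_minReps {σ : Finset B} {s j : B} {u : W} (hu : u ∈ minReps cs hM σ s)
    (hj : j ∈ σ) (h : state cs hM s u j ≠ 0) : cs.simple j * u ∈ minReps cs hM σ s := by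
  refine ⟨mul_mem (simple_mem_parabolic hj) hu.1, fun t ht => ?_⟩
  by_contra hneg
  rw [← not_isRightDescent_iff_nonneg, not_not, isRightDescent_iff_nonpos hM, rep_mul,
    rep_simple] at hneg
  have hy := hu.2 t ht
  have hyk : ∀ k, k ≠ j → rep cs hM u (root t) k = 0 := fun k hk =>
    le_antisymm (by simpa [refl_apply_of_ne hk] using hneg k) (hy k)
  have e : rep cs hM u (root t) = rep cs hM u (root t) j • root j := by
    ext k
    rcases eq_or_ne k j with rfl | hk
    · have : (root k : B → ℤ) k = 1 := by simp [root]
      rw [Pi.smul_apply, this, smul_eq_mul, mul_one]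
    · have : (root j : B → ℤ) k = 0 := by simp [root, hk]
      rw [hyk k hk, Pi.smul_apply, this, smul_zero]
  have e2 := congrArg (fun v => rep cs hM u⁻¹ v s) e
  simp only [rep_inv_apply, map_smul, Pi.smul_apply, smul_eq_mul] at e2
  have hts : s ≠ t := (Finset.ne_of_mem_erase ht).symm
  have e3 : (root t : B → ℤ) s = 0 := by simp [root, hts]
  rw [e3, eq_comm, mul_eq_zero] at e2
  rcases e2 with e2 | e2
  · rw [e2, zero_smul] at e
    exact rep_root_ne_zero hM u t e
  · exact h e2

lemma state_injOn (σ : Finset B) (s : B) : Set.InjOn (state cs hM s) (minReps cs hM σ s) := by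
  intro u hu u' hu' h
  induction hn : cs.length u using Nat.strong_induction_on generalizing u u' with
  | _ n ih =>
  subst hn
  by_cases h1 : u = 1
  · by_contra hne
    subst h1
    obtain ⟨j, -, hj⟩ := exists_state_neg hM hu' (fun h' => hne h'.symm)
    rw [← h] at hj
    exact cs.not_isLeftDescent_one j (isLeftDescent_of_state_neg hM hj)
  · obtain ⟨j, hjσ, hj⟩ := exists_state_neg hM hu h1
    have hl := isLeftDescent_of_state_neg hM hj
    have := ih _ hl (simple_mul_mem_minReps hM hu hjσ hj.ne)
      (simple_mul_mem_minReps hM hu' hjσ (h ▸ hj).ne)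
      (by rw [state_simple_mul, state_simple_mul, h]) rfl
    exact mul_left_cancel this

/-- The weights in the `W_σ`-orbit of the `s`-th fundamental weight which are obtained from it
by `n` successive lowering reflections. -/
def level (M : CoxeterMatrix B) (σ : Finset B) (s : B) : ℕ → Finset (B → ℤ)
  | 0 => {root s}
  | n + 1 => (level M σ s n).biUnion fun x => (σ.filter (0 < x ·)).image (step M x)

lemma mem_level_iff (σ : Finset B) (s : B) (n : ℕ) (x : B → ℤ) :
    x ∈ level M σ s n ↔ ∃ u ∈ minReps cs hM σ s, cs.length u = n ∧ state cs hM s u = x := by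
  induction n generalizing x with
  | zero =>
    simp only [level, Finset.mem_singleton, cs.length_eq_zero_iff]
    constructor
    · rintro rfl
      exact ⟨1, ⟨one_mem _, fun t _ => by rw [map_one]; simp [root]⟩, rfl, state_one hM s⟩
    · rintro ⟨u, -, rfl, rfl⟩
      exact state_one hM s
  | succ n ih =>
    simp only [level, Finset.mem_biUnion, Finset.mem_image, Finset.mem_filter, ih]
    constructor
    · rintro ⟨_, ⟨u, hu, rfl, rfl⟩, j, ⟨hjσ, hj⟩, rfl⟩
      exact ⟨_, simple_mul_mem_minReps hM hu hjσ hj.ne',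
        cs.not_isLeftDescent_iff.1 (not_isLeftDescent_of_state_pos hM hj),
        state_simple_mul hM s j u⟩
    · rintro ⟨u, hu, hl, rfl⟩
      have h1 : u ≠ 1 := by rintro rfl; simp at hl
      obtain ⟨j, hjσ, hj⟩ := exists_state_neg hM hu h1
      have hd := cs.isLeftDescent_iff.1 (isLeftDescent_of_state_neg hM hj)
      refine ⟨_, ⟨_, simple_mul_mem_minReps hM hu hjσ hj.ne, by omega, rfl⟩, j, ⟨hjσ, ?_⟩, ?_⟩
      · rw [state_simple_mul]
        simp only [step, cartan_self]
        linarith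
      · rw [← state_simple_mul, cs.simple_mul_simple_cancel_left]

lemma level_eq_empty {σ : Finset B} {s : B} {N n : ℕ} (h : level M σ s N = ∅) (hn : N ≤ n) :
    level M σ s n = ∅ := by
  induction n, hn using Nat.le_induction with
  | base => exact h
  | succ n _ ih => simp [level, ih]

lemma minReps_length_lt {σ : Finset B} {s : B} {N : ℕ} (h : level M σ s N = ∅) {u : W}
    (hu : u ∈ minReps cs hM σ s) : cs.length u < N := by
  by_contra hN
  have := (mem_level_iff hM σ s _ _).2 ⟨u, hu, rfl, rfl⟩
  rw [level_eq_empty h (not_lt.1 hN)] at this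
  simp at this

lemma minReps_finite {σ : Finset B} {s : B} {N : ℕ} (h : level M σ s N = ∅) :
    (minReps cs hM σ s).Finite := by
  refine Set.Finite.of_finite_image ?_ (state_injOn hM σ s)
  refine ((Finset.range N).biUnion (level M σ s)).finite_toSet.subset ?_
  rintro _ ⟨u, hu, rfl⟩
  rw [Finset.mem_coe, Finset.mem_biUnion]
  exact ⟨_, Finset.mem_range.2 (minReps_length_lt hM h hu),
    (mem_level_iff hM σ s _ _).2 ⟨u, hu, rfl, rfl⟩⟩

lemma sum_minReps {σ : Finset B} {s : B} {N : ℕ} (h : level M σ s N = ∅) :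
    ∑ u ∈ (minReps_finite (cs := cs) hM h).toFinset, (X : ℚ[X]) ^ cs.length u =
      ∑ n ∈ Finset.range N, ((level M σ s n).card : ℚ[X]) * X ^ n := by
  rw [← Finset.sum_fiberwise_of_maps_to (g := cs.length) (t := Finset.range N)]
  · refine Finset.sum_congr rfl fun n _ => ?_
    have : level M σ s n = ((minReps_finite (cs := cs) hM h).toFinset.filter
        (cs.length · = n)).image (state cs hM s) := by
      ext x
      rw [mem_level_iff (cs := cs) hM]
      simp [and_assoc]
    rw [this, Finset.card_image_of_injOn ((state_injOn hM σ s).mono fun u hu => by simp_all),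
      ← nsmul_eq_mul]
    exact Finset.sum_eq_card_nsmul fun u hu => by simp_all
  · intro u hu
    rw [Finset.mem_range]
    exact minReps_length_lt hM h ((Set.Finite.mem_toFinset _).1 hu)

lemma poin_of_finite {σ : Finset B} (h : (parabolic cs σ : Set W).Finite) :
    poin cs σ = ∑ w ∈ h.toFinset, X ^ cs.length w := by
  unfold poin
  rw [dif_pos h]

include hM in
lemma finite_and_poin_eq {σ : Finset B} {s : B} {N : ℕ} (h : level M σ s N = ∅)
    (hf : (parabolic cs (σ.erase s) : Set W).Finite) :
    (parabolic cs σ : Set W).Finite ∧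
      poin cs σ = (∑ n ∈ Finset.range N, ((level M σ s n).card : ℚ[X]) * X ^ n) *
        poin cs (σ.erase s) := by
  have hsub : parabolic cs (σ.erase s) ≤ parabolic cs σ :=
    Subgroup.closure_mono (Set.image_mono (by simp))
  have hfin : (parabolic cs σ : Set W).Finite := by
    refine (Set.Finite.image2 (· * ·) (minReps_finite (cs := cs) hM h) hf).subset ?_
    intro w hw
    obtain ⟨u, hu, v, hv, h1, rfl⟩ := exists_mul_eq hM (Finset.erase_subset s σ) hw
    exact ⟨u, ⟨hu, h1⟩, v, hv, rfl⟩
  refine ⟨hfin, ?_⟩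
  rw [poin_of_finite hfin, poin_of_finite hf, ← sum_minReps (cs := cs) hM h, Finset.sum_mul_sum,
    ← Finset.sum_product']
  symm
  refine Finset.sum_bij (fun p _ => p.1 * p.2) ?_ ?_ ?_ ?_
  · rintro ⟨u, v⟩ hp
    simp only [Finset.mem_product, Set.Finite.mem_toFinset] at hp ⊢
    exact mul_mem hp.1.1 (hsub hp.2)
  · rintro ⟨u, v⟩ hp ⟨u', v'⟩ hp' he
    simp only [Finset.mem_product, Set.Finite.mem_toFinset] at hp hp'
    obtain ⟨h1, h2⟩ := eq_of_mul_eq hM hp.1.2 hp'.1.2 hp.2 hp'.2 he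
    rw [h1, h2]
  · intro w hw
    obtain ⟨u, hu, v, hv, h1, rfl⟩ := exists_mul_eq hM (Finset.erase_subset s σ)
      ((Set.Finite.mem_toFinset _).1 hw)
    refine ⟨(u, v), ?_, rfl⟩
    simp only [Finset.mem_product, Set.Finite.mem_toFinset]
    exact ⟨⟨hu, h1⟩, hv⟩
  · rintro ⟨u, v⟩ hp
    simp only [Finset.mem_product, Set.Finite.mem_toFinset] at hp
    rw [length_mul_of_nonneg hM hp.1.2 hp.2, pow_add]

lemma finite_and_poin_empty :
    (parabolic cs (∅ : Finset B) : Set W).Finite ∧ poin cs (∅ : Finset B) = 1 := by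
  have h : parabolic cs (∅ : Finset B) = ⊥ := by simp [parabolic]
  have hf : (parabolic cs (∅ : Finset B) : Set W).Finite := by rw [h]; simp
  refine ⟨hf, ?_⟩
  have : hf.toFinset = {1} := by
    ext w; simp [h]
  rw [poin_of_finite hf, this]
  simp

end SimplyLaced

end

namespace AffineE8

open SimplyLaced

/-! ### Polynomials given by coefficient lists -/

/-- The polynomial with the given list of coefficients. -/
noncomputable def ofCoeffs : List ℤ → ℚ[X]
  | [] => 0
  | a :: l => (a : ℚ[X]) + X * ofCoeffs l

/-- Addition of coefficient lists. -/
def addCoeffs : List ℤ → List ℤ → List ℤ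
  | [], m => m
  | l, [] => l
  | a :: l, b :: m => (a + b) :: addCoeffs l m

/-- Multiplication of coefficient lists. -/
def mulCoeffs : List ℤ → List ℤ → List ℤ
  | [], _ => []
  | a :: l, m => addCoeffs (m.map (a * ·)) (0 :: mulCoeffs l m)

lemma ofCoeffs_addCoeffs (l m : List ℤ) :
    ofCoeffs (addCoeffs l m) = ofCoeffs l + ofCoeffs m := by
  induction l generalizing m with
  | nil => simp [addCoeffs, ofCoeffs]
  | cons a l ih =>
    cases m with
    | nil => simp [addCoeffs, ofCoeffs]
    | cons b m => simp only [addCoeffs, ofCoeffs, ih, Int.cast_add]; ring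

lemma ofCoeffs_map_mul (a : ℤ) (m : List ℤ) :
    ofCoeffs (m.map (a * ·)) = (a : ℚ[X]) * ofCoeffs m := by
  induction m with
  | nil => simp [ofCoeffs]
  | cons b m ih => simp only [List.map_cons, ofCoeffs, ih, Int.cast_mul]; ring

lemma ofCoeffs_mulCoeffs (l m : List ℤ) :
    ofCoeffs (mulCoeffs l m) = ofCoeffs l * ofCoeffs m := by
  induction l with
  | nil => simp [mulCoeffs, ofCoeffs]
  | cons a l ih =>
    simp only [mulCoeffs, ofCoeffs, ofCoeffs_addCoeffs, ofCoeffs_map_mul, ih, Int.cast_zero]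
    ring

/-- The product of a list of coefficient lists. -/
def prodCoeffs (L : List (List ℤ)) : List ℤ := L.foldr mulCoeffs [1]

lemma ofCoeffs_prodCoeffs (L : List (List ℤ)) :
    ofCoeffs (prodCoeffs L) = (L.map ofCoeffs).prod := by
  induction L with
  | nil => simp [prodCoeffs, ofCoeffs]
  | cons l L ih =>
    rw [List.map_cons, List.prod_cons, ← ih, ← ofCoeffs_mulCoeffs]
    rfl

lemma ofCoeffs_eq_sum (l : List ℤ) :
    ofCoeffs l = ∑ n ∈ Finset.range l.length, ((l.getD n 0 : ℤ) : ℚ[X]) * X ^ n := by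
  induction l with
  | nil => simp [ofCoeffs]
  | cons a l ih =>
    rw [List.length_cons, Finset.sum_range_succ', ofCoeffs, ih, Finset.mul_sum, add_comm]
    congr 1
    · refine Finset.sum_congr rfl fun n _ => ?_
      rw [List.getD_cons_succ]
      ring
    · simp

/-! ### The cyclotomic polynomials which occur -/

/-- The indices of the cyclotomic polynomials dividing the Poincaré polynomials. -/
def indices : List ℕ := [2, 3, 4, 5, 6, 7, 8, 9, 10, 12, 14, 15, 18, 20, 24, 30]

/-- The coefficients of the relevant cyclotomic polynomials. -/
def cycCoeffs : ℕ → List ℤ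
  | 1 => [-1, 1]
  | 2 => [1, 1]
  | 3 => [1, 1, 1]
  | 4 => [1, 0, 1]
  | 5 => [1, 1, 1, 1, 1]
  | 6 => [1, -1, 1]
  | 7 => [1, 1, 1, 1, 1, 1, 1]
  | 8 => [1, 0, 0, 0, 1]
  | 9 => [1, 0, 0, 1, 0, 0, 1]
  | 10 => [1, -1, 1, -1, 1]
  | 12 => [1, 0, -1, 0, 1]
  | 14 => [1, -1, 1, -1, 1, -1, 1]
  | 15 => [1, -1, 0, 1, -1, 1, 0, -1, 1]
  | 18 => [1, 0, 0, -1, 0, 0, 1]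
  | 20 => [1, 0, -1, 0, 1, 0, -1, 0, 1]
  | 24 => [1, 0, 0, 0, -1, 0, 0, 0, 1]
  | 30 => [1, 1, 0, -1, -1, -1, 0, 1, 1]
  | _ => []

lemma cycCoeffs_table : ∀ d ∈ 1 :: indices, 0 < d ∧
    (∀ e ∈ (List.range d).filter (fun e => e ≠ 0 ∧ e ∣ d), e ∈ 1 :: indices) ∧
    mulCoeffs (cycCoeffs d)
      (prodCoeffs (((List.range d).filter (fun e => e ≠ 0 ∧ e ∣ d)).map cycCoeffs)) =
      -1 :: (List.replicate (d - 1) 0 ++ [1]) := by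
  decide +kernel

lemma ofCoeffs_replicate_append (n : ℕ) :
    ofCoeffs (List.replicate n 0 ++ [1]) = X ^ n := by
  induction n with
  | zero => simp [ofCoeffs]
  | succ n ih => rw [List.replicate_succ, List.cons_append, ofCoeffs, ih]; push_cast; ring

lemma ofCoeffs_cycCoeffs (d : ℕ) (hd : d ∈ 1 :: indices) :
    ofCoeffs (cycCoeffs d) = cyclotomic d ℚ := by
  induction d using Nat.strong_induction_on with
  | _ d ih =>
  obtain ⟨h0, h1, h2⟩ := cycCoeffs_table d hd
  rw [eq_cyclotomic_iff h0]
  have h3 : d.properDivisors = ((List.range d).filter (fun e => e ≠ 0 ∧ e ∣ d)).toFinset := by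
    ext e
    simp only [Nat.mem_properDivisors, List.mem_toFinset, List.mem_filter, List.mem_range,
      decide_eq_true_eq]
    constructor
    · rintro ⟨h, h'⟩
      exact ⟨h', by rintro rfl; simp at h; omega, h⟩
    · rintro ⟨h, -, h'⟩
      exact ⟨h', h⟩
  have h4 := congrArg ofCoeffs h2
  rw [ofCoeffs_mulCoeffs, ofCoeffs_prodCoeffs, ofCoeffs, ofCoeffs_replicate_append,
    List.map_map] at h4
  rw [h3, List.prod_toFinset _ (List.nodup_range.filter _)]
  rw [List.map_congr_left (g := fun i => cyclotomic i ℚ)] at h4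
  · rw [h4, ← pow_succ', Nat.sub_add_cancel h0]
    push_cast
    ring
  · intro e he
    exact ih e (List.mem_range.1 (List.mem_filter.1 he).1) (h1 e he)

end AffineE8

namespace AffineE8
open SimplyLaced

/-- The entry at position `n` of a table with 4-bit entries. -/
def entry (T n : ℕ) : ℕ := (T >>> (4 * n)) % 16

/-- The exponent of the `d`-th cyclotomic polynomial in the Poincaré polynomials, tabulated over
the subsets of the generators. -/
def expTable : ℕ → ℕ
  | 2 => 17234618829319753748489530985792894237543688037280548328112345912225751088708700774254291288224747282572867625344966948544438496222988053122883623300697132564469329671502836064790567770555335389164396463182338055402280149025741887251233217004479413892034476400743645090677584475929538201149081965920875724607529532605665101188630883350303877346468711371786135082847203540756109198171353566224301684946244855786392971589082467230791900185069838836391427928120102607176952987351860178556482938483496214480348541620386414162084380513633982934564023329315508460778635255975796931770792849316343462903681479340891240997136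
  | 3 => 8601067331586134151486807916335441346558372926030782973038265051682420820839494844258042940082573342506595233741573004533856596315305076118068202656941779125375842709515361517616230252834120521658203206627016223937089941711955754534423742455238443321321909399454715090424523873791254445504819098615408086649284752767891456759892359921421562053751782903515652921166928584937692449333084088765326290782073662585808136942046959758023394821192759775813762545788668459552618931671057129989511895667406905516415291844360636084954997082063808790826033266128545148155283338211879534303114994858039771006892676556854063529984
  | 4 => 8617309410633087853875761690746718295010361910973551401129323433264805869179830476012657387607445048557054450967422118169680274703739335925654629034222781507667213484999753638563289695689325062806070129560382731103780246539658886489714366249681005771923006420241012439715880216865831246409050932974172007561953185339109830414797223075625304905264285333686529475537568671082871876568012806457028938235942876431937309205165820969241972124871299609998218411957900837113444767735145216318084470267087059883985647133134783092907438269666502238536016727078545159483548661286502291859941501747043201322348982455065682903040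
  | 5 => 4300518255843730398610755726018319128075448945971367167507800586748195373528453883258515792860362971252940460739585630313410880541567756924615468210982416710099710049491394489769259456980066309370223505430456946799775490989843695668589932909082538511452556286160671663100322933373091513706121880335443181583956166192530989235102925111449079747697259950694503238157384682964337951029605184440113645994742981792753197435036648162887023390808287909885533338522523247371548263307461262042924335512098210586158961688018092343237702165271810615241081073585935282244148579896600178739675898377752787789758834689903702310912
  | 6 => 8601003637128875886115092155925706689611535144953636097306458186090465233207616114922310974572809622811277118573882493583013994117856929199363791147692456760005851750145327290119594435357669861259709536997705833798775710430840715678450023527539740295738816528595856436760862324345052312852690529399736856162783505255932712793776397082578633586446994976773731406098249059742858300409632298309773602369298861001372880564833448653483348006297122338006844863712054115275347952237383095653044671290424863060084088141034943748778833287695996220792828870157912536629649077719741824422901909783436402521731611948732406300672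
  | 7 => 2154467071420733369690403300899382962543927346240540489221179598528428644817918678345846963305229322945562638999592924044599054600953092004067612554935850916294895671877003777042340917404565997126316363297043078536626567745116951967278028900240929084376613698853343074016330409092026246686210932154842306654995395258864294463539991240742521174978810284709926080863258026315719959748797705245276076364936978463381740838456126041740590815088484628384048258355583016379893513231155067604646978387689401414466641737182460765724408931784300189113795079535154860091182837336234542505262557478117253237760062455302636699648
  | 8 => 4308408142350205124879993865977981241163526574037246297690961011691786525065827006153812305315656485327847396021541187913623644793923568918538684558404299080176694870692676459209846076621675264812963183630542436686359360425510273473239385738720153580358847691405425983636167191086052331023375987444231199709704770517100586279964086618293404835520884379955874418065474859879350447410718975536934170309985784000077918680291633493781671843372867842663895345055427962876339978228400505505775878218152851373177144031210696290231556961622637182426598274568563800938562201488035999111688670632990257898668994123500410109952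
  | 9 => 2146082004321669932718924530470042004453281594467447566613514273791145621571338507238388753784728081910168168805002713004526164305044302281011842074513963190435185237009631604068299323002291636893660471427737081583700363877052529145486584675597677060220853720549905490727367363444803336049373417370117394776802548030066201007114323412241937988909372617031582446657258582597503057643510866294278907130016084141825680422298091956282441906504708421297063859041487677065258666853029133915303495819941759521914429741922360422166165858452024557948874598727556603703934228681753255953675942895888886651057309745279909494784
  | 10 => 4300485381285145487511206658964395920517471609231395511538829688620643882233686469720043846281300786084431599993894540832644907765982533613132687026400992997665739158939086714418845742510195251821417521123465778548307875652805891319082489329923258707793312583551156864609108724214624556226600104869992018007467656152678206788190927101920857780010351644076244329988466784356750694079661805841540657436982531125537535790555785760425208631884351198669065815879384771620761581767826848666156913476538272967330277851311743971185150489936229270218461934753954425086096688908297011095003539572433556593808384264315475066880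
  | 12 => 4300485381285145487511206658964395920517471609231395511538829688620643882233686469720043846281300786084431599993894540832644907765982533613132687026400993157725548759163907049817214111577929312390109767516872704776728438580054551712263783761350640836241923046945792704828176668203252054329301372383354495129221807718384440352887201861210084409768643927263187872325796532163597192879201461291728330363987272677986755757544787679690375657228873339868089396778233966627932013122961370701590476336392336594535717242318750531946973684541578070338229166928736907340966184470545912903216746433183245872681812723579907735552
  | 14 => 2153941078483375242454873373048558809863583991414142368352437573660700891823958548301473629234803558492924805500897988115696933507833013051503678125366304026350641972967082991466749019984466558875811458808313097202042059494491014021528759705665037729118356766993630682790114311130544669372524854726765867980354372624181570428109676566875387925988804939324051919100003400164129257428834455013456372481351367837872869821890895032203989424242155921196353503307281341786073774154691730773955588989988083229422236495968359400730355039027714485350034847776225928005819023896357215622421287977152934397401358632196547543040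
  | 15 => 2146051184422996578563097280106988997373241192910793861508655751046559130315445879626376656233943472198078927092469790357031376974837287728970697619412581300979394200172331771717786569361812835216925702548941986955880733269236468182622060952164433195312062419861785881754253086547648901352845276504323502163564623701657663363873611606920303443017792939845888574169229282064950958109546192736540609682386761657582192434429107715153015506207531173339308044628772980198676315000327904552061213786554033199158340718246733847249148256101566315818999718080548573063442329306112903433478180219860103590978318403859426312192
  | 18 => 2146051184422996578563097280106988997373241192910793861508655751046559130315445879626376656233943472198078927092469790357031376974837287728970697619412581300979394200172331771717786569361812835216925702548941986955880733269236468182622060952164433195312062419861785881754253086547648901352845276504323502163576561507631358430448376524202886810389474818221677328753792998391831643612255241069572032004577887096484699996764317430310044514292863527176723694319675558770637464173072878183690658056949281636778272008033628761586056699850870491541876760577400381781321074156261212300974677020462272251846291285123534946304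
  | 20 => 2146051184422996578563097280106988997373241192910793861508655751046559130315445879626376656233943472198078927092469790357031376974837287728970697619412581300979394200172331771717786569361812835216925702548941986955880733269236468182622060952164433195312062419861785881754253086547648901352845276504323502163564623701657663363873611606920303443017792939845888574169229282064950958109546192736540609682386761657582192434429107715153015506207531173339308044628772980198676315000327904552061213786554033199158340718246733847249148256101566315818999718080548573063442329306112903433478180219860103590978318403859426312192
  | 24 => 2146051184422996578563097280106988997373241192910793861508655751046559130315445879626376656233943472198078927092469790357031376974837287728970697619412581300979394200172331771717786569361812835216925702548941986955880733269236468182622060952164433195312062419861785881754253086547648901352845276504323502163564623701657663363873611606920303443017792939845888574169229282064950958109546192736540609682386761657582192434429107715153015506207531173339308044628772980198676315000327904552061213786554033199158340718246733847249148256101566315818999718080548573063442329306112903433478180219860103590978318403859426312192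
  | 30 => 2146051184422996578563097280106988997373241192910793861508655751046559130315445879626376656233943472198078927092469790357031376974837287728970697619412581300979394200172331771717786569361812835216925702548941986955880733269236468182622060952164433195312062419861785881754253086547648901352845276504323502163564623701657663363873611606920303443017792939845888574169229282064950958109546192736540609682386761657582192434429107715153015506207531173339308044628772980198676315000327904552061213786554033199158340718246733847249148256101566315818999718080548573063442329306112903433478180219860103590978318403859426312192
  | _ => 0

/-- For each proper nonempty subset, an end node used to compute its Poincaré polynomial. -/
def nodeTable : ℕ :=
  1013853336075397104645058879445779306095149075961872596438352374921381851079290544872283630726686037895385126264115527062573251813121259836805887626886709159224118632001527832873283687113720225574478150638600615074979848520725022038415884376202600188443931385672481756735988495068350199181939737867798752373288745038881946289875748916249931955244057703911607803947800018878953788666156109782091585114936652143925379579796000734154632851980087447675830478915280678952883878213208808819845590408636922763792621618516160895257903754127556238579776678047882995690471265892696108594503408797715572808315733933582538899712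

/-- The Cartan matrix of affine type `E₈`. -/
def cartanTable : List (List ℤ) :=
  [[2, 0, 0, 0, 0, 0, 0, 0, -1],
    [0, 2, 0, -1, 0, 0, 0, 0, 0],
    [0, 0, 2, 0, -1, 0, 0, 0, 0],
    [0, -1, 0, 2, -1, 0, 0, 0, 0],
    [0, 0, -1, -1, 2, -1, 0, 0, 0],
    [0, 0, 0, 0, -1, 2, -1, 0, 0],
    [0, 0, 0, 0, 0, -1, 2, -1, 0],
    [0, 0, 0, 0, 0, 0, -1, 2, -1],
    [-1, 0, 0, 0, 0, 0, 0, -1, 2]]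
/-- The exponent of the `d`-th cyclotomic polynomial in the Poincaré polynomial of `W_σ`, where `σ`
is the subset encoded by `n`. -/
def expo (d n : ℕ) : ℕ := entry (expTable d) n

/-- The subset of the generators encoded by the binary digits of `n`. -/
def subset (n : ℕ) : Finset (Fin 9) := Finset.univ.filter fun i => n.testBit i

lemma mem_subset {n : ℕ} {i : Fin 9} : i ∈ subset n ↔ n.testBit i := by simp [subset]

lemma subset_xor_two_pow {n : ℕ} {s : Fin 9} (hs : n.testBit s) :
    subset (n ^^^ 2 ^ (s : ℕ)) = (subset n).erase s := by
  ext i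
  simp only [mem_subset, Finset.mem_erase, Nat.testBit_xor, Nat.testBit_two_pow, ne_eq, Fin.ext_iff]
  by_cases h : (s : ℕ) = i
  · simp [← h, hs]
  · simp [h, Ne.symm h]

/-! ### Orbits of weights -/

/-- The `j`-th simple reflection on weights given as lists of coordinates. -/
def listStep (l : List ℤ) (j : ℕ) : List ℤ :=
  List.zipWith (fun a c => a - c * l.getD j 0) l (cartanTable.getD j [])

/-- The weight with the given list of coordinates. -/
def weight (l : List ℤ) : Fin 9 → ℤ := fun i => l.getD i 0

/-- The next level of the orbit. -/
def nextLevel (n : ℕ) (L : List (List ℤ)) : List (List ℤ) :=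
  (L.flatMap fun l => ((List.range 9).filter fun j => n.testBit j ∧ 0 < l.getD j 0).map
    (listStep l)).dedup

/-- The sizes of the successive levels of an orbit. -/
def levelSizes (n : ℕ) : ℕ → List (List ℤ) → Option (List ℤ)
  | 0, _ => none
  | _ + 1, [] => some []
  | f + 1, L => (levelSizes n f (nextLevel n L)).map fun l => (L.length : ℤ) :: l

/-- The coefficients of the quotient of the Poincaré polynomials of the subsets encoded by `n`
and `m`, according to the table of exponents. -/
def quotCoeffs (n m : ℕ) : List ℤ :=
  prodCoeffs (indices.flatMap fun d => List.replicate (expo d n - expo d m) (cycCoeffs d))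

/-- The initial weight for the subset encoded by `n`. -/
def initWeight (s : ℕ) : List ℤ := (List.range 9).map fun i => if i = s then 1 else 0

/-- The correctness of the table of exponents at `n`. -/
def ExpoCorrect (n : ℕ) : Prop :=
  n.testBit (entry nodeTable n) ∧ entry nodeTable n < 9 ∧
    n ^^^ 2 ^ entry nodeTable n < n ∧
    (∀ d ∈ indices, expo d (n ^^^ 2 ^ entry nodeTable n) ≤ expo d n) ∧
    levelSizes n 64 [initWeight (entry nodeTable n)] =
      some (quotCoeffs n (n ^^^ 2 ^ entry nodeTable n))

instance (n : ℕ) : Decidable (ExpoCorrect n) := by unfold ExpoCorrect; infer_instance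

lemma expoCorrect : ∀ n < 511, 0 < n → ExpoCorrect n := by decide +kernel

end AffineE8

namespace AffineE8
open SimplyLaced

section Coxeter

variable {M : CoxeterMatrix (Fin 9)}

/-- The Coxeter matrix has affine type `E₈`. -/
def IsAffineE8 (M : CoxeterMatrix (Fin 9)) : Prop :=
  ∀ i j : Fin 9, i.val < j.val →
    M.M i j = (if (i.val, j.val) ∈ ([(0, 8), (1, 3), (2, 4), (3, 4), (4, 5), (5, 6), (6, 7), (7, 8)] : List (ℕ × ℕ)) then 3 else 2)

lemma IsAffineE8.isSimplyLaced (hM : IsAffineE8 M) : IsSimplyLaced M := by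
  intro i j hij
  rcases lt_or_gt_of_ne (Fin.val_ne_of_ne hij) with h | h
  · rw [hM i j h]; split_ifs <;> simp
  · rw [M.symmetric, hM j i h]; split_ifs <;> simp

lemma cartanTable_eq : ∀ i j : Fin 9, (cartanTable.getD i []).getD j 0 =
    if i.val < j.val then if (i.val, j.val) ∈ ([(0, 8), (1, 3), (2, 4), (3, 4), (4, 5), (5, 6), (6, 7), (7, 8)] : List (ℕ × ℕ)) then -1 else 0
    else if j.val < i.val then if (j.val, i.val) ∈ ([(0, 8), (1, 3), (2, 4), (3, 4), (4, 5), (5, 6), (6, 7), (7, 8)] : List (ℕ × ℕ)) then -1 else 0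
    else 2 := by
  decide +kernel

lemma IsAffineE8.cartan_eq (hM : IsAffineE8 M) (i j : Fin 9) :
    cartan M i j = (cartanTable.getD i []).getD j 0 := by
  rw [cartanTable_eq]
  rcases lt_trichotomy i.val j.val with h | h | h
  · have hij : i ≠ j := by rintro rfl; simp at h
    rw [if_pos h, cartan, if_neg hij, hM i j h]
    by_cases h' : (i.val, j.val) ∈ ([(0, 8), (1, 3), (2, 4), (3, 4), (4, 5), (5, 6), (6, 7), (7, 8)] : List (ℕ × ℕ))
    · rw [if_pos h', if_pos h', if_pos rfl]
    · rw [if_neg h', if_neg h', if_neg (by norm_num)]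
  · rw [if_neg (by omega), if_neg (by omega), Fin.ext h, cartan_self]
  · have hij : i ≠ j := by rintro rfl; simp at h
    rw [if_neg (by omega), if_pos h, cartan, if_neg hij, M.symmetric, hM j i h]
    by_cases h' : (j.val, i.val) ∈ ([(0, 8), (1, 3), (2, 4), (3, 4), (4, 5), (5, 6), (6, 7), (7, 8)] : List (ℕ × ℕ))
    · rw [if_pos h', if_pos h', if_pos rfl]
    · rw [if_neg h', if_neg h', if_neg (by norm_num)]

lemma length_listStep {l : List ℤ} (hl : l.length = 9) (j : Fin 9) :
    (listStep l j).length = 9 := by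
  have : ∀ j : Fin 9, (cartanTable.getD j []).length = 9 := by decide
  rw [listStep, List.length_zipWith, hl, this, min_self]

lemma weight_listStep (hM : IsAffineE8 M) {l : List ℤ} (hl : l.length = 9) (j : Fin 9) :
    weight (listStep l j) = step M (weight l) j := by
  have h9 : ∀ j : Fin 9, (cartanTable.getD j []).length = 9 := by decide
  ext i
  have h1 : (i : ℕ) < (listStep l j).length := by rw [length_listStep hl]; exact i.2
  have h2 : (i : ℕ) < l.length := by rw [hl]; exact i.2
  have h3 : (i : ℕ) < (cartanTable.getD j []).length := by rw [h9]; exact i.2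
  rw [step, hM.cartan_eq, weight, List.getD_eq_getElem _ _ h1]
  simp only [listStep, List.getElem_zipWith, weight]
  rw [List.getD_eq_getElem l _ h2, List.getD_eq_getElem (cartanTable.getD j []) _ h3]

lemma weight_injOn {l m : List ℤ} (hl : l.length = 9) (hm : m.length = 9)
    (h : weight l = weight m) : l = m := by
  refine List.ext_getElem (hl.trans hm.symm) fun i h1 h2 => ?_
  have := congrFun h ⟨i, hl ▸ h1⟩
  simpa [weight, List.getD_eq_getElem, h1, h2] using this

lemma length_of_mem_nextLevel {n : ℕ} {L : List (List ℤ)} (hL : ∀ l ∈ L, l.length = 9) :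
    ∀ l ∈ nextLevel n L, l.length = 9 := by
  intro l hl
  simp only [nextLevel, List.mem_dedup, List.mem_flatMap, List.mem_map, List.mem_filter,
    List.mem_range] at hl
  obtain ⟨l', hl', j, ⟨hj, -⟩, rfl⟩ := hl
  exact length_listStep (hL l' hl') ⟨j, hj⟩

lemma level_succ_eq (hM : IsAffineE8 M) {n k : ℕ} {s : Fin 9} {L : List (List ℤ)}
    (hL : ∀ l ∈ L, l.length = 9) (h : level M (subset n) s k = (L.map weight).toFinset) :
    level M (subset n) s (k + 1) = ((nextLevel n L).map weight).toFinset := by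
  ext x
  simp only [level, h, Finset.mem_biUnion, Finset.mem_image, Finset.mem_filter, List.mem_toFinset,
    List.mem_map, nextLevel, List.mem_dedup, List.mem_flatMap, List.mem_filter, List.mem_range,
    mem_subset, decide_eq_true_eq]
  constructor
  · rintro ⟨_, ⟨l, hl, rfl⟩, j, ⟨hj, hp⟩, rfl⟩
    exact ⟨_, ⟨l, hl, j, ⟨j.2, hj, hp⟩, rfl⟩, weight_listStep hM (hL l hl) j⟩
  · rintro ⟨_, ⟨l, hl, j, ⟨hj9, hj, hp⟩, rfl⟩, rfl⟩
    exact ⟨_, ⟨l, hl, rfl⟩, ⟨j, hj9⟩, ⟨hj, hp⟩, (weight_listStep hM (hL l hl) ⟨j, hj9⟩).symm⟩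

lemma card_toFinset_map_weight {L : List (List ℤ)} (hL : ∀ l ∈ L, l.length = 9) (hn : L.Nodup) :
    (L.map weight).toFinset.card = L.length := by
  rw [List.toFinset_card_of_nodup, List.length_map]
  exact hn.map_on fun l hl m hm h => weight_injOn (hL l hl) (hL m hm) h

lemma level_of_levelSizes (hM : IsAffineE8 M) {n : ℕ} {s : Fin 9} (f k : ℕ) (L : List (List ℤ))
    (r : List ℤ) (hr : levelSizes n f L = some r) (hL : ∀ l ∈ L, l.length = 9) (hn : L.Nodup)
    (h : level M (subset n) s k = (L.map weight).toFinset) :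
    level M (subset n) s (k + r.length) = ∅ ∧
      ∀ i < r.length, r.getD i 0 = (level M (subset n) s (k + i)).card := by
  induction f generalizing k L r with
  | zero => simp [levelSizes] at hr
  | succ f ih =>
    cases L with
    | nil =>
      simp only [levelSizes, Option.some.injEq] at hr
      subst hr
      simpa using h
    | cons l L =>
      simp only [levelSizes, Option.map_eq_some_iff] at hr
      obtain ⟨r', hr', rfl⟩ := hr
      obtain ⟨h1, h2⟩ := ih (k + 1) _ r' hr' (length_of_mem_nextLevel hL) (List.nodup_dedup _)
        (level_succ_eq hM hL h)
      refine ⟨by rw [List.length_cons, add_comm _ 1, ← add_assoc]; exact h1, fun i hi => ?_⟩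
      cases i with
      | zero => rw [List.getD_cons_zero, add_zero, h, card_toFinset_map_weight hL hn]
      | succ i =>
        rw [List.getD_cons_succ, h2 i (by simpa using hi), add_comm i 1, add_assoc]

lemma weight_initWeight (s : Fin 9) : weight (initWeight s) = root s := by
  revert s
  have : ∀ s i : Fin 9, (initWeight s).getD i 0 = if i = s then 1 else 0 := by decide +kernel
  intro s
  ext i
  rw [weight, this, root, Pi.single_apply]

variable {W : Type*} [Group W] (cs : CoxeterSystem M W)

lemma subset_zero : subset 0 = ∅ := by simp [subset]

lemma expo_zero : ∀ d ∈ indices, expo d 0 = 0 := by decide +kernel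

lemma prod_flatMap_replicate (l : List ℕ) (e : ℕ → ℕ) (F : ℕ → List ℤ) :
    ((l.flatMap fun d => List.replicate (e d) (F d)).map ofCoeffs).prod =
      (l.map fun d => ofCoeffs (F d) ^ e d).prod := by
  induction l with
  | nil => simp
  | cons d l ih => simp [List.flatMap_cons, ih, List.prod_append]

/-- Every proper subset of the generators generates a finite group, whose Poincaré polynomial is
the product of cyclotomic polynomials described by the table of exponents. -/
lemma finite_and_poin_subset (hM : IsAffineE8 M) (n : ℕ) (hn : n < 511) :
    (parabolic cs (subset n) : Set W).Finite ∧
      poin cs (subset n) = (indices.map fun d => cyclotomic d ℚ ^ expo d n).prod := by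
  induction n using Nat.strong_induction_on with
  | _ n ih =>
  rcases Nat.eq_zero_or_pos n with rfl | h0
  · rw [subset_zero]
    obtain ⟨h1, h2⟩ := finite_and_poin_empty (cs := cs)
    refine ⟨h1, h2.trans (List.prod_eq_one ?_).symm⟩
    intro x hx
    obtain ⟨d, hd, rfl⟩ := List.mem_map.1 hx
    rw [expo_zero d hd, pow_zero]
  · obtain ⟨h1, h2, h3, h4, h5⟩ := expoCorrect n hn h0
    generalize hs : entry nodeTable n = t at h1 h2 h3 h4 h5
    obtain ⟨s, rfl⟩ : ∃ s : Fin 9, (s : ℕ) = t := ⟨⟨t, h2⟩, rfl⟩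
    generalize hm : n ^^^ 2 ^ (s : ℕ) = m at h3 h4 h5
    have he : subset m = (subset n).erase s := by rw [← hm, subset_xor_two_pow h1]
    obtain ⟨hf, hp⟩ := ih m h3 (h3.trans hn)
    obtain ⟨h6, h7⟩ := level_of_levelSizes (s := s) hM 64 0 _ _ h5
      (by simp [initWeight]) (List.nodup_singleton _) (by simp [level, weight_initWeight])
    rw [zero_add] at h6
    obtain ⟨h8, h9⟩ := finite_and_poin_eq (cs := cs) hM.isSimplyLaced h6 (he ▸ hf)
    refine ⟨h8, ?_⟩
    rw [h9, ← he, hp]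
    have h10 : ∑ i ∈ Finset.range (quotCoeffs n m).length,
        ((level M (subset n) s i).card : ℚ[X]) * X ^ i = ofCoeffs (quotCoeffs n m) := by
      rw [ofCoeffs_eq_sum]
      refine Finset.sum_congr rfl fun i hi => ?_
      rw [h7 i (Finset.mem_range.1 hi), zero_add]
      push_cast
      rfl
    rw [h10, quotCoeffs, ofCoeffs_prodCoeffs, prod_flatMap_replicate, ← List.prod_map_mul]
    congr 1
    refine List.map_congr_left fun d hd => ?_
    rw [ofCoeffs_cycCoeffs d (List.mem_cons_of_mem _ hd), ← pow_add, Nat.sub_add_cancel (h4 d hd)]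

/-- The coefficients of the minimal imaginary root. -/
def marks : List ℤ := [1, 2, 3, 4, 6, 5, 4, 3, 2]

include cs in
lemma infinite (hM : IsAffineE8 M) : Infinite W := by
  refine infinite_of_fixed hM.isSimplyLaced (weight marks) ?_ ?_ ?_ cs
  · have : ∀ i : Fin 9, 0 ≤ marks.getD i 0 := by decide
    exact this
  · intro h
    have := congrFun h 0
    simp [weight, marks] at this
  · intro i
    rw [coroot_apply]
    simp only [hM.cartan_eq]
    revert i
    have : ∀ i : Fin 9, ∑ j : Fin 9, (cartanTable.getD i []).getD j 0 * marks.getD j 0 = 0 := by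
      decide +kernel
    exact this

lemma subset_511 : subset 511 = Finset.univ := by decide

lemma parabolic_univ_infinite (hM : IsAffineE8 M) :
    ¬ (parabolic cs (subset 511) : Set W).Finite := by
  have : parabolic cs (subset 511) = ⊤ := by
    rw [subset_511, parabolic, Finset.coe_univ, Set.image_univ, cs.subgroup_closure_range_simple]
  rw [this]
  have := infinite cs hM
  exact Set.infinite_univ

end Coxeter

end AffineE8

namespace AffineE8

/-! ### Chain complexes with weights and discrete Morse theory -/

open Matrix

/-- Data of discrete Morse type for a based chain complex `ε` (over `ℤ`) graded by `deg` and
weighted by `v`. The cells satisfying `lower` are matched with the remaining ones by `mate`, the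
row of a lower cell `a` in `Y` is a chain with leading cell `mate a`, and the boundaries of these
chains form a triangular system with respect to the rank function `rk`. -/
structure MorseData {ι : Type*} [Fintype ι] [DecidableEq ι] (ε : Matrix ι ι ℤ) (deg v : ι → ℕ) where
  /-- the lower cells -/
  lower : ι → Prop
  /-- the matching -/
  mate : ι → ι
  /-- the rank function -/
  rk : ι → ℕ
  /-- the chains associated with the lower cells -/
  Y : Matrix ι ι ℤ
  Y_of_not_lower : ∀ a b, ¬ lower a → Y a b = 0
  diag_mul_diag : ∀ a, lower a → (Y * ε) a a * (Y * ε) a a = 1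
  of_boundary : ∀ a t, lower a → (Y * ε) a t ≠ 0 →
    v t ≤ v a ∧ deg t = deg a ∧ (lower t → t ≠ a → rk t < rk a)
  of_Y : ∀ a b, lower a → Y a b ≠ 0 → ¬ lower b ∧ v b ≤ v (mate a) ∧ deg b = deg a + 1
  of_not_lower : ∀ b, ¬ lower b → lower (mate b) ∧ mate (mate b) = b
  Y_mate : ∀ a, lower a → Y a (mate a) = 1
  Y_mate_of_Y : ∀ a b c, lower a → Y a b ≠ 0 → b ≠ mate a → Y (mate b) c = if c = b then 1 else 0

namespace MorseData

variable {ι : Type*} [Fintype ι] [DecidableEq ι] {ε : Matrix ι ι ℤ} {deg v : ι → ℕ}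
  (𝔐 : MorseData ε deg v)

open Classical in
/-- The rows of the matrix of projections to the lower cells. -/
noncomputable def projRow (a : ι) : ι → ℤ :=
  if 𝔐.lower a then (𝔐.Y * ε) a a • (Pi.single a 1 - ∑ t,
    if _h : 𝔐.lower t ∧ t ≠ a ∧ 𝔐.rk t < 𝔐.rk a then (𝔐.Y * ε) a t • projRow t else 0) else 0
termination_by 𝔐.rk a
decreasing_by exact _h.2.2

/-- The matrix of projections to the lower cells. -/
noncomputable def L : Matrix ι ι ℤ := Matrix.of 𝔐.projRow

/-- The contracting homotopy. -/
noncomputable def H : Matrix ι ι ℤ := 𝔐.L * 𝔐.Y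

lemma L_of_not_lower {a : ι} (ha : ¬ 𝔐.lower a) (c : ι) : 𝔐.L a c = 0 := by
  rw [L, Matrix.of_apply, projRow, if_neg ha]; rfl

open Classical in
lemma L_of_lower {a : ι} (ha : 𝔐.lower a) (c : ι) :
    𝔐.L a c = (𝔐.Y * ε) a a * ((if c = a then 1 else 0) -
      ∑ t ∈ Finset.univ.erase a, (𝔐.Y * ε) a t * 𝔐.L t c) := by
  conv_lhs => rw [L, Matrix.of_apply, projRow, if_pos ha]
  simp only [Pi.smul_apply, Pi.sub_apply, Finset.sum_apply, smul_eq_mul, Pi.single_apply]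
  congr 2
  rw [← Finset.add_sum_erase _ _ (Finset.mem_univ a), dif_neg (by simp)]
  rw [Pi.zero_apply, zero_add]
  refine Finset.sum_congr rfl fun t ht => ?_
  have hta := Finset.ne_of_mem_erase ht
  by_cases hl : 𝔐.lower t
  · by_cases h0 : (𝔐.Y * ε) a t = 0
    · split_ifs <;> simp [h0]
    · rw [dif_pos ⟨hl, hta, (𝔐.of_boundary a t ha h0).2.2 hl hta⟩]
      rfl
  · rw [dif_neg (by tauto), 𝔐.L_of_not_lower hl, mul_zero, Pi.zero_apply]

lemma boundary_of_not_lower {a : ι} (ha : ¬ 𝔐.lower a) (c : ι) : (𝔐.Y * ε) a c = 0 := by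
  rw [Matrix.mul_apply]
  exact Finset.sum_eq_zero fun b _ => by rw [𝔐.Y_of_not_lower a b ha, zero_mul]

lemma boundary_mul_L_apply {a : ι} (ha : 𝔐.lower a) (c : ι) :
    (𝔐.Y * ε * 𝔐.L) a c = if c = a then 1 else 0 := by
  rw [Matrix.mul_apply, ← Finset.add_sum_erase _ _ (Finset.mem_univ a), 𝔐.L_of_lower ha,
    ← mul_assoc, 𝔐.diag_mul_diag a ha]
  ring

/-- The row of an upper cell is determined by the rows of `Y * X`. -/
lemma row_of_not_lower (X : Matrix ι ι ℤ) {b : ι} (hb : ¬ 𝔐.lower b) (c : ι) :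
    X b c = (𝔐.Y * X) (𝔐.mate b) c -
      ∑ b' ∈ Finset.univ.erase b, 𝔐.Y (𝔐.mate b) b' * (𝔐.Y * X) (𝔐.mate b') c := by
  obtain ⟨h1, h2⟩ := 𝔐.of_not_lower b hb
  have h3 := 𝔐.Y_mate _ h1
  rw [h2] at h3
  conv_rhs => rw [Matrix.mul_apply, ← Finset.add_sum_erase _ _ (Finset.mem_univ b), h3, one_mul]
  rw [eq_comm, sub_eq_iff_eq_add]
  congr 1
  refine Finset.sum_congr rfl fun b' hb' => ?_
  by_cases h0 : 𝔐.Y (𝔐.mate b) b' = 0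
  · rw [h0, zero_mul, zero_mul]
  · congr 1
    rw [Matrix.mul_apply]
    simp [𝔐.Y_mate_of_Y _ b' _ h1 h0 (by rw [h2]; exact Finset.ne_of_mem_erase hb')]

lemma of_L (a c : ι) (h : 𝔐.L a c ≠ 0) : 𝔐.lower c ∧ v c ≤ v a ∧ deg c = deg a := by
  induction hn : 𝔐.rk a using Nat.strong_induction_on generalizing a with
  | _ n ih =>
  subst hn
  by_cases ha : 𝔐.lower a
  · by_cases hca : c = a
    · subst hca; exact ⟨ha, le_rfl, rfl⟩
    rw [𝔐.L_of_lower ha, if_neg hca, zero_sub] at h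
    obtain ⟨t, ht, h1⟩ := Finset.exists_ne_zero_of_sum_ne_zero
      (neg_ne_zero.1 (right_ne_zero_of_mul h))
    have h2 := left_ne_zero_of_mul h1
    have h3 := right_ne_zero_of_mul h1
    have ht1 : 𝔐.lower t := by
      by_contra hl
      exact h3 (𝔐.L_of_not_lower hl c)
    obtain ⟨h4, h5, h6⟩ := 𝔐.of_boundary a t ha h2
    obtain ⟨h7, h8, h9⟩ := ih _ (h6 ht1 (Finset.ne_of_mem_erase ht)) t h3 rfl
    exact ⟨h7, h8.trans h4, h9.trans h5⟩
  · exact absurd (𝔐.L_of_not_lower ha c) h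

lemma Y_mul_L : 𝔐.Y * 𝔐.L = 0 := by
  ext a c
  rw [Matrix.mul_apply, Matrix.zero_apply]
  refine Finset.sum_eq_zero fun b _ => ?_
  by_cases ha : 𝔐.lower a
  · by_cases h : 𝔐.Y a b = 0
    · rw [h, zero_mul]
    · rw [𝔐.L_of_not_lower (𝔐.of_Y a b ha h).1, mul_zero]
  · rw [𝔐.Y_of_not_lower a b ha, zero_mul]

lemma boundary_mul_L_mul {X : Matrix ι ι ℤ} (hX : ∀ a c, ¬ 𝔐.lower a → X a c = 0) :
    𝔐.Y * ε * 𝔐.L * X = X := by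
  ext a c
  by_cases ha : 𝔐.lower a
  · rw [Matrix.mul_apply]
    simp [𝔐.boundary_mul_L_apply ha]
  · rw [hX a c ha, Matrix.mul_assoc, Matrix.mul_apply]
    exact Finset.sum_eq_zero fun b _ => by rw [𝔐.boundary_of_not_lower ha, zero_mul]

/-- The matrix `H` is a contracting homotopy. -/
lemma homotopy (hε : ε * ε = 0) : ε * 𝔐.H + 𝔐.H * ε = 1 := by
  have hD : 𝔐.Y * ε * ε = 0 := by rw [Matrix.mul_assoc, hε, Matrix.mul_zero]
  set K : Matrix ι ι ℤ := 1 - (ε * 𝔐.H + 𝔐.H * ε) with hK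
  have h1 : 𝔐.Y * K = 0 := by
    have e1 : 𝔐.Y * (ε * 𝔐.H) = 𝔐.Y := by
      rw [H, ← Matrix.mul_assoc, ← Matrix.mul_assoc]
      exact 𝔐.boundary_mul_L_mul 𝔐.Y_of_not_lower
    have e2 : 𝔐.Y * (𝔐.H * ε) = 0 := by
      rw [H, ← Matrix.mul_assoc, ← Matrix.mul_assoc, Y_mul_L, Matrix.zero_mul, Matrix.zero_mul]
    rw [hK, Matrix.mul_sub, Matrix.mul_add, e1, e2, Matrix.mul_one, add_zero, sub_self]
  have h2 : ε * K = K * ε := by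
    rw [hK, Matrix.mul_sub, Matrix.sub_mul, Matrix.mul_add, Matrix.add_mul, Matrix.mul_one,
      Matrix.one_mul, ← Matrix.mul_assoc ε ε, hε, Matrix.mul_assoc 𝔐.H ε ε, hε, Matrix.mul_zero,
      Matrix.zero_mul, zero_add, add_zero, Matrix.mul_assoc]
  have h3 : 𝔐.Y * ε * K = 0 := by
    rw [Matrix.mul_assoc, h2, ← Matrix.mul_assoc, h1, Matrix.zero_mul]
  have h4 : ∀ b c, ¬ 𝔐.lower b → K b c = 0 := fun b c hb => by
    rw [𝔐.row_of_not_lower K hb, h1]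
    simp
  have h5 : ∀ n a c, 𝔐.rk a = n → K a c = 0 := by
    intro n
    induction n using Nat.strong_induction_on with
    | _ n ih =>
    rintro a c rfl
    by_cases ha : 𝔐.lower a
    · have h6 := congrFun (congrFun h3 a) c
      rw [Matrix.mul_apply, ← Finset.add_sum_erase _ _ (Finset.mem_univ a),
        Finset.sum_eq_zero, add_zero, Matrix.zero_apply] at h6
      · rw [← one_mul (K a c), ← 𝔐.diag_mul_diag a ha, mul_assoc, h6, mul_zero]
      · intro t ht
        by_cases h0 : (𝔐.Y * ε) a t = 0
        · rw [h0, zero_mul]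
        by_cases hl : 𝔐.lower t
        · rw [ih _ ((𝔐.of_boundary a t ha h0).2.2 hl (Finset.ne_of_mem_erase ht)) t c rfl,
            mul_zero]
        · rw [h4 t c hl, mul_zero]
    · exact h4 a c ha
  have h6 : K = 0 := by
    ext a c
    exact h5 _ a c rfl
  rw [hK, sub_eq_zero] at h6
  exact h6.symm

lemma of_boundary_L (hε : ε * ε = 0) (a c : ι) (h : (ε * 𝔐.L) a c ≠ 0) :
    v (𝔐.mate c) ≤ v a := by
  have hN : ∀ b c, ¬ 𝔐.lower b → (ε * 𝔐.L) b c ≠ 0 → v (𝔐.mate c) ≤ v b := by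
    intro b c hb h
    by_contra hv
    have h1 : ∀ b', ¬ 𝔐.lower b' → v b' ≤ v b → (𝔐.Y * (ε * 𝔐.L)) (𝔐.mate b') c = 0 := by
      intro b' hb' h'
      obtain ⟨h2, h3⟩ := 𝔐.of_not_lower b' hb'
      rw [← Matrix.mul_assoc, 𝔐.boundary_mul_L_apply h2, if_neg]
      rintro rfl
      rw [h3] at hv
      exact hv h'
    refine h ?_
    rw [𝔐.row_of_not_lower (ε * 𝔐.L) hb, h1 b hb le_rfl, Finset.sum_eq_zero, sub_zero]
    intro b' _
    obtain ⟨h2, h3⟩ := 𝔐.of_not_lower b hb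
    by_cases h0 : 𝔐.Y (𝔐.mate b) b' = 0
    · rw [h0, zero_mul]
    · obtain ⟨h4, h5, -⟩ := 𝔐.of_Y _ b' h2 h0
      rw [h1 b' h4 (h3 ▸ h5), mul_zero]
  induction hn : 𝔐.rk a using Nat.strong_induction_on generalizing a with
  | _ n ih =>
  subst hn
  by_cases ha : 𝔐.lower a
  · by_contra hv
    refine h ?_
    have h3 : (𝔐.Y * ε * (ε * 𝔐.L)) a c = 0 := by
      rw [← Matrix.mul_assoc, Matrix.mul_assoc 𝔐.Y, hε, Matrix.mul_zero, Matrix.zero_mul]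
      rfl
    rw [Matrix.mul_apply, ← Finset.add_sum_erase _ _ (Finset.mem_univ a),
      Finset.sum_eq_zero, add_zero] at h3
    · rw [← one_mul ((ε * 𝔐.L) a c), ← 𝔐.diag_mul_diag a ha, mul_assoc, h3, mul_zero]
    · intro t ht
      by_cases h0 : (𝔐.Y * ε) a t = 0
      · rw [h0, zero_mul]
      obtain ⟨h4, -, h5⟩ := 𝔐.of_boundary a t ha h0
      by_contra hne
      have hne' := right_ne_zero_of_mul hne
      by_cases hl : 𝔐.lower t
      · exact hv ((ih _ (h5 hl (Finset.ne_of_mem_erase ht)) t hne' rfl).trans h4)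
      · exact hv ((hN t c hl hne').trans h4)
  · exact hN a c ha h

/-! #### Coefficients in a ring -/

variable {A : Type*} [CommRing A]

/-- An integer matrix acting on row vectors over a ring. -/
def act (A : Type*) [CommRing A] (X : Matrix ι ι ℤ) : (ι → A) →ₗ[A] (ι → A) :=
  Matrix.vecMulLinear (X.map (Int.castRingHom A))

lemma act_apply (X : Matrix ι ι ℤ) (x : ι → A) (t : ι) : act A X x t = ∑ s, x s * (X s t : A) := by
  simp [act, Matrix.vecMul, dotProduct]

lemma act_act (X Z : Matrix ι ι ℤ) (x : ι → A) : act A Z (act A X x) = act A (X * Z) x := by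
  simp only [act, Matrix.vecMulLinear_apply, Matrix.vecMul_vecMul, Matrix.map_mul]

lemma act_zero (x : ι → A) : act A (0 : Matrix ι ι ℤ) x = 0 := by
  ext t; simp [act_apply]

lemma act_one (x : ι → A) : act A (1 : Matrix ι ι ℤ) x = x := by
  ext t; simp [act_apply, Matrix.one_apply]

lemma act_add (X Z : Matrix ι ι ℤ) (x : ι → A) : act A (X + Z) x = act A X x + act A Z x := by
  ext t; simp [act_apply, mul_add, Finset.sum_add_distrib]

/-- Chains of degree `k` whose coefficient at `s` is divisible by `w s`. -/
def chains (deg : ι → ℕ) (w : ι → A) (k : ℕ) : Submodule A (ι → A) where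
  carrier := {x | ∀ s, w s ∣ x s ∧ (deg s ≠ k → x s = 0)}
  add_mem' hx hy s := ⟨dvd_add (hx s).1 (hy s).1, fun h => by
    rw [Pi.add_apply, (hx s).2 h, (hy s).2 h, add_zero]⟩
  zero_mem' s := ⟨dvd_zero _, fun _ => rfl⟩
  smul_mem' c x hx s := ⟨Dvd.dvd.mul_left (hx s).1 c, fun h => by
    rw [Pi.smul_apply, (hx s).2 h, smul_zero]⟩

lemma act_mem_chains {X : Matrix ι ι ℤ} {w w' : ι → A} {k k' : ℕ}
    (hX : ∀ s t, X s t ≠ 0 → w' t ∣ w s ∧ (deg s = k → deg t = k')) {x : ι → A}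
    (hx : x ∈ chains deg w k) : act A X x ∈ chains deg w' k' := by
  intro t
  rw [act_apply]
  constructor
  · refine Finset.dvd_sum fun s _ => ?_
    by_cases h : X s t = 0
    · simp [h]
    · exact ((hX s t h).1.trans (hx s).1).mul_right _
  · intro ht
    refine Finset.sum_eq_zero fun s _ => ?_
    by_cases h : X s t = 0
    · simp [h]
    · rw [(hx s).2 fun h' => ht ((hX s t h).2 h'), zero_mul]

variable (p : A)

lemma act_L_mem {k : ℕ} {x : ι → A} (hx : x ∈ chains deg (fun s => p ^ v s) k) :
    act A 𝔐.L x ∈ chains deg (fun s => p ^ v s) k :=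
  act_mem_chains (fun s t h => by
    obtain ⟨-, h1, h2⟩ := 𝔐.of_L s t h
    exact ⟨pow_dvd_pow p h1, fun h => h2.trans h⟩) hx

lemma act_L_of_not_lower (x : ι → A) {a : ι} (ha : ¬ 𝔐.lower a) : act A 𝔐.L x a = 0 := by
  rw [act_apply]
  refine Finset.sum_eq_zero fun s _ => ?_
  by_cases h : 𝔐.L s a = 0
  · simp [h]
  · exact absurd (𝔐.of_L s a h).1 ha

/-- A cycle whose projections to the lower cells are sufficiently divisible is a boundary. -/
lemma exists_act_eq (hε : ε * ε = 0) {k : ℕ} {x : ι → A}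
    (hx : x ∈ chains deg (fun s => p ^ v s) k) (hc : act A ε x = 0)
    (h : ∀ a, 𝔐.lower a → deg a = k → p ^ v (𝔐.mate a) ∣ act A 𝔐.L x a) :
    ∃ u ∈ chains deg (fun s => p ^ v s) (k + 1), act A ε u = x := by
  refine ⟨act A 𝔐.H x, ?_, ?_⟩
  · rw [H, ← act_act]
    have h1 := 𝔐.act_L_mem p hx
    have h2 : act A 𝔐.L x ∈ chains deg (fun a => p ^ v (𝔐.mate a)) k := by
      intro a
      refine ⟨?_, (h1 a).2⟩
      by_cases ha : 𝔐.lower a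
      · by_cases hk : deg a = k
        · exact h a ha hk
        · rw [(h1 a).2 hk]; exact dvd_zero _
      · rw [𝔐.act_L_of_not_lower x ha]; exact dvd_zero _
    refine act_mem_chains (fun a b hab => ?_) h2
    have ha : 𝔐.lower a := by
      by_contra ha
      exact hab (𝔐.Y_of_not_lower a b ha)
    obtain ⟨-, h3, h4⟩ := 𝔐.of_Y a b ha hab
    exact ⟨pow_dvd_pow p h3, fun h => by rw [h4, h]⟩
  · rw [act_act]
    have := congrArg (fun X => act A X x) (𝔐.homotopy hε)
    simp only [act_add, act_one] at this
    rwa [← act_act, hc, map_zero, zero_add] at this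

/-- The projections of a boundary to the lower cells. -/
lemma dvd_act_L_act (hε : ε * ε = 0) {k : ℕ} {u : ι → A}
    (hu : u ∈ chains deg (fun s => p ^ v s) k) (a : ι) :
    p ^ v (𝔐.mate a) ∣ act A 𝔐.L (act A ε u) a := by
  rw [act_act, act_apply]
  refine Finset.dvd_sum fun s _ => ?_
  by_cases h : (ε * 𝔐.L) s a = 0
  · simp [h]
  · exact ((pow_dvd_pow p (𝔐.of_boundary_L hε s a h)).trans (hu s).1).mul_right _

/-- The cycle associated with a lower cell. -/
def cyc (A : Type*) [CommRing A] (a : ι) : ι → A := fun t => ((𝔐.Y * ε) a t : A)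

lemma cyc_eq (a : ι) : 𝔐.cyc A a = act A (𝔐.Y * ε) (Pi.single a 1) := by
  ext t
  simp [cyc, act_apply, Pi.single_apply]

lemma act_cyc (hε : ε * ε = 0) (a : ι) : act A ε (𝔐.cyc A a) = 0 := by
  rw [cyc_eq, act_act, Matrix.mul_assoc, hε, Matrix.mul_zero, act_zero]

lemma smul_cyc_mem {a : ι} (ha : 𝔐.lower a) :
    p ^ v a • 𝔐.cyc A a ∈ chains deg (fun s => p ^ v s) (deg a) := by
  intro t
  rw [Pi.smul_apply, smul_eq_mul, cyc]
  by_cases h : (𝔐.Y * ε) a t = 0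
  · simp [h]
  · obtain ⟨h1, h2, -⟩ := 𝔐.of_boundary a t ha h
    exact ⟨(pow_dvd_pow p h1).mul_right _, fun h' => absurd h2 h'⟩

lemma act_L_cyc {a : ι} (ha : 𝔐.lower a) : act A 𝔐.L (𝔐.cyc A a) = Pi.single a 1 := by
  rw [cyc_eq, act_act]
  ext c
  rw [act_apply]
  simp [Pi.single_apply, 𝔐.boundary_mul_L_apply ha]

end MorseData

/-! ### From local to global -/

section LocalGlobal

open MorseData

variable {ι P : Type*} [Fintype ι] [DecidableEq ι] [Fintype P] [DecidableEq P] [Nonempty P]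
  {ε : Matrix ι ι ℤ} {deg : ι → ℕ} {v : P → ι → ℕ} {A : Type*} [CommRing A] {Φ : P → A}

/-- The weight at `s`. -/
def totalWeight (Φ : P → A) (v : P → ι → ℕ) (s : ι) : A := ∏ p, Φ p ^ v p s

lemma mem_chains_of_mem {k : ℕ} {x : ι → A} (hx : x ∈ chains deg (totalWeight Φ v) k) (p : P) :
    x ∈ chains deg (fun s => Φ p ^ v p s) k := fun s =>
  ⟨(Finset.dvd_prod_of_mem (fun p => Φ p ^ v p s) (Finset.mem_univ p)).trans (hx s).1, (hx s).2⟩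

lemma smul_mem_chains {k e : ℕ} (he : ∀ p s, v p s ≤ e) {p : P} {x : ι → A}
    (hx : x ∈ chains deg (fun s => Φ p ^ v p s) k) (c : A) :
    (c * ∏ q ∈ {p}ᶜ, Φ q ^ e) • x ∈ chains deg (totalWeight Φ v) k := by
  intro s
  refine ⟨?_, fun h => by rw [Pi.smul_apply, (hx s).2 h, smul_zero]⟩
  rw [totalWeight, Fintype.prod_eq_mul_prod_compl p, mul_comm, Pi.smul_apply, smul_eq_mul]
  refine mul_dvd_mul (Dvd.dvd.mul_left ?_ _) (hx s).1
  exact Finset.prod_dvd_prod_of_dvd _ _ fun q _ => pow_dvd_pow _ (he q s)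

lemma exists_partition (hΦ : Pairwise (Function.onFun IsCoprime Φ)) (e : ℕ) :
    ∃ c : P → A, ∑ p, c p * ∏ q ∈ {p}ᶜ, Φ q ^ e = 1 := by
  rw [exists_sum_eq_one_iff_pairwise_coprime']
  exact fun p q h => (hΦ h).pow

/-- A chain which is locally a boundary is a boundary. -/
lemma exists_act_eq_of_forall (hΦ : Pairwise (Function.onFun IsCoprime Φ)) {e k : ℕ}
    (he : ∀ p s, v p s ≤ e) {x : ι → A}
    (h : ∀ p, ∃ u ∈ chains deg (fun s => Φ p ^ v p s) k, act A ε u = x) :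
    ∃ u ∈ chains deg (totalWeight Φ v) k, act A ε u = x := by
  choose u hu hux using h
  obtain ⟨c, hc⟩ := exists_partition hΦ e
  refine ⟨∑ p, (c p * ∏ q ∈ {p}ᶜ, Φ q ^ e) • u p,
    Submodule.sum_mem _ fun p _ => smul_mem_chains he (hu p) _, ?_⟩
  rw [map_sum]
  simp only [map_smul, hux]
  rw [← Finset.sum_smul, hc, one_smul]

variable (ε) in
/-- The cycles of degree `k`. -/
def zChains (deg : ι → ℕ) (w : ι → A) (k : ℕ) : Submodule A (ι → A) :=
  chains deg w k ⊓ LinearMap.ker (act A ε)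

variable [IsDomain A] (𝔐 : ∀ p, MorseData ε deg (v p))

/-- The component of the comparison map at a lower cell. -/
noncomputable def component {p : P} (hp : Φ p ≠ 0) (k : ℕ) (a : ι) :
    zChains ε deg (totalWeight Φ v) k →ₗ[A] A :=
  (LinearEquiv.toSpanNonzeroSingleton A A (Φ p ^ v p a) (pow_ne_zero _ hp)).symm.toLinearMap ∘ₗ
    LinearMap.codRestrict _
      ((LinearMap.proj a ∘ₗ act A (𝔐 p).L) ∘ₗ (zChains ε deg (totalWeight Φ v) k).subtype)
      (fun x => Ideal.mem_span_singleton.2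
        ((𝔐 p).act_L_mem (Φ p) (mem_chains_of_mem x.2.1 p) a).1)

lemma component_mul {p : P} (hp : Φ p ≠ 0) {k : ℕ} (a : ι)
    (x : zChains ε deg (totalWeight Φ v) k) :
    component 𝔐 hp k a x * Φ p ^ v p a = act A (𝔐 p).L x a := by
  have h1 := LinearEquiv.apply_symm_apply
    (LinearEquiv.toSpanNonzeroSingleton A A (Φ p ^ v p a) (pow_ne_zero _ hp))
    (LinearMap.codRestrict _
      ((LinearMap.proj a ∘ₗ act A (𝔐 p).L) ∘ₗ (zChains ε deg (totalWeight Φ v) k).subtype)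
      (fun x => Ideal.mem_span_singleton.2
        ((𝔐 p).act_L_mem (Φ p) (mem_chains_of_mem x.2.1 p) a).1) x)
  exact congrArg Subtype.val h1

/-- The homology of the complex of weighted chains. -/
lemma exists_surjective_ker (hε : ε * ε = 0) (hΦ : Pairwise (Function.onFun IsCoprime Φ))
    (h0 : ∀ p, Φ p ≠ 0) {e : ℕ} (he : ∀ p s, v p s ≤ e) (k : ℕ)
    {I : Type*} [Fintype I] [DecidableEq I] (bar : I → P × ι) (hinj : Function.Injective bar)
    (hbar : ∀ i, (𝔐 (bar i).1).lower (bar i).2 ∧ deg (bar i).2 = k ∧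
      v (bar i).1 ((𝔐 (bar i).1).mate (bar i).2) = v (bar i).1 (bar i).2 + 1)
    (hall : ∀ p a, (𝔐 p).lower a → deg a = k → v p ((𝔐 p).mate a) ≠ v p a → ∃ i, bar i = (p, a)) :
    ∃ θ : zChains ε deg (totalWeight Φ v) k →ₗ[A] (∀ i, A ⧸ Ideal.span {Φ (bar i).1}),
      Function.Surjective θ ∧ ∀ x, θ x = 0 ↔
        ∃ u ∈ chains deg (totalWeight Φ v) (k + 1), act A ε u = x := by
  let θ : zChains ε deg (totalWeight Φ v) k →ₗ[A] (∀ i, A ⧸ Ideal.span {Φ (bar i).1}) :=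
    LinearMap.pi fun i => (Submodule.mkQ (Ideal.span {Φ (bar i).1})) ∘ₗ
      component 𝔐 (h0 (bar i).1) k (bar i).2
  have hθ : ∀ i x, θ x i = 0 ↔
      Φ (bar i).1 ∣ component 𝔐 (h0 (bar i).1) k (bar i).2 x := fun i x => by
    simp only [θ, LinearMap.pi_apply, LinearMap.comp_apply, Submodule.mkQ_apply]
    rw [Submodule.Quotient.mk_eq_zero, Ideal.mem_span_singleton]
  have hθ' : ∀ i x c, act A (𝔐 (bar i).1).L x.1 (bar i).2 =
      c * Φ (bar i).1 ^ v (bar i).1 (bar i).2 → θ x i = Submodule.Quotient.mk c := fun i x c h => by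
    have h1 := component_mul 𝔐 (h0 (bar i).1) (bar i).2 x
    rw [h] at h1
    have h2 := mul_right_cancel₀ (pow_ne_zero _ (h0 _)) h1
    simp only [θ, LinearMap.pi_apply, LinearMap.comp_apply, Submodule.mkQ_apply, h2]
  refine ⟨θ, ?_, fun x => ⟨fun hx => ?_, ?_⟩⟩
  · obtain ⟨c, hc⟩ := exists_partition hΦ (e + 1)
    have hdvd : ∀ p q, q ≠ p → Φ q ^ (e + 1) ∣ c p * ∏ q ∈ {p}ᶜ, Φ q ^ (e + 1) := fun p q h =>
      Dvd.dvd.mul_left (Finset.dvd_prod_of_mem (fun q => Φ q ^ (e + 1)) (by simpa using h)) _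
    set m : P → A := fun p => c p * ∏ q ∈ {p}ᶜ, Φ q ^ (e + 1) with hm
    have hm1 : ∀ p, Φ p ∣ m p - 1 := fun p => by
      rw [← hc, Fintype.sum_eq_add_sum_compl p]
      have : Φ p ∣ ∑ i ∈ {p}ᶜ, m i := Finset.dvd_sum fun i hi =>
        (dvd_pow_self _ (Nat.succ_ne_zero e)).trans (hdvd i p (by simpa [eq_comm] using hi))
      have h2 := (dvd_neg.2 this)
      convert h2 using 1
      simp only [hm]
      ring
    let z : I → zChains ε deg (totalWeight Φ v) k := fun i =>
      ⟨m (bar i).1 • (Φ (bar i).1 ^ v (bar i).1 (bar i).2 • (𝔐 (bar i).1).cyc A (bar i).2), by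
        refine ⟨smul_mem_chains (fun p s => (he p s).trans (Nat.le_succ e)) ?_ _, ?_⟩
        · have := (𝔐 (bar i).1).smul_cyc_mem (Φ (bar i).1) (hbar i).1
          rwa [(hbar i).2.1] at this
        · change act A ε _ = 0
          rw [map_smul, map_smul, act_cyc _ hε, smul_zero, smul_zero]⟩
    have hz : ∀ i j, θ (z i) j = Submodule.Quotient.mk (if i = j then 1 else 0) := by
      intro i j
      by_cases hp : (bar i).1 = (bar j).1
      · have h3 : act A (𝔐 (bar j).1).L (z i).1 (bar j).2 = (m (bar j).1 * if i = j then 1 else 0) *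
            Φ (bar j).1 ^ v (bar j).1 (bar j).2 := by
          simp only [z, map_smul]
          rw [← hp, act_L_cyc _ (hbar i).1]
          by_cases hij : i = j
          · subst hij
            simp
          · have : (bar j).2 ≠ (bar i).2 := fun h => hij (hinj (Prod.ext hp h.symm))
            simp [hij, this]
        rw [hθ' j _ _ h3, Submodule.Quotient.eq, Ideal.mem_span_singleton]
        split_ifs
        · rw [mul_one]; exact hm1 _
        · simp
      · obtain ⟨r, hr⟩ := hdvd (bar i).1 (bar j).1 (Ne.symm hp)
        have h3 : act A (𝔐 (bar j).1).L (z i).1 (bar j).2 =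
            (Φ (bar j).1 * (Φ (bar j).1 ^ (e - v (bar j).1 (bar j).2) * r *
              act A (𝔐 (bar j).1).L
                (Φ (bar i).1 ^ v (bar i).1 (bar i).2 • (𝔐 (bar i).1).cyc A (bar i).2) (bar j).2)) *
            Φ (bar j).1 ^ v (bar j).1 (bar j).2 := by
          simp only [z]
          rw [map_smul, Pi.smul_apply, smul_eq_mul]
          have h4 : m (bar i).1 = Φ (bar j).1 ^ (e + 1) * r := hr
          have h5 : Φ (bar j).1 ^ (e + 1) = Φ (bar j).1 * Φ (bar j).1 ^ (e - v (bar j).1 (bar j).2)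
              * Φ (bar j).1 ^ v (bar j).1 (bar j).2 := by
            rw [mul_assoc, ← pow_add, Nat.sub_add_cancel (he _ _), ← pow_succ']
          rw [h4, h5]
          ring
        rw [hθ' j _ _ h3, if_neg (fun h => hp (by rw [h])), Submodule.Quotient.mk_zero,
          Submodule.Quotient.mk_eq_zero, Ideal.mem_span_singleton]
        exact Dvd.intro _ rfl
    intro t
    choose r hr using fun i => Submodule.Quotient.mk_surjective _ (t i)
    refine ⟨∑ i, r i • z i, ?_⟩
    ext j
    rw [map_sum, Finset.sum_apply, Finset.sum_eq_single j]
    · rw [map_smul, Pi.smul_apply, hz, if_pos rfl, ← Submodule.Quotient.mk_smul, smul_eq_mul,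
        mul_one, hr]
    · intro i _ hij
      rw [map_smul, Pi.smul_apply, hz, if_neg hij, Submodule.Quotient.mk_zero, smul_zero]
    · simp
  · refine exists_act_eq_of_forall hΦ he fun p => ?_
    refine (𝔐 p).exists_act_eq (Φ p) hε (mem_chains_of_mem x.2.1 p) x.2.2 fun a ha hk => ?_
    by_cases hv : v p ((𝔐 p).mate a) = v p a
    · rw [hv]
      exact ((𝔐 p).act_L_mem (Φ p) (mem_chains_of_mem x.2.1 p) a).1
    · obtain ⟨i, hi⟩ := hall p a ha hk hv
      have h1 := (hθ i x).1 (congrFun hx i)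
      have h2 := component_mul 𝔐 (h0 (bar i).1) (bar i).2 x
      have h3 := (hbar i).2.2
      rw [hi] at h2 h3
      rw [h3, ← h2, pow_succ']
      refine mul_dvd_mul ?_ dvd_rfl
      convert h1 using 3 <;> rw [hi]
  · rintro ⟨u, hu, hux⟩
    ext i
    rw [Pi.zero_apply, hθ]
    have h1 := (𝔐 (bar i).1).dvd_act_L_act (Φ (bar i).1) hε (mem_chains_of_mem hu _) (bar i).2
    rw [hux, ← component_mul 𝔐 (h0 (bar i).1), (hbar i).2.2, pow_succ'] at h1
    exact (mul_dvd_mul_iff_right (pow_ne_zero _ (h0 _))).1 h1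

end LocalGlobal

end AffineE8

namespace AffineE8

/-! ### Acyclic matchings -/

/-- For each index `d`, a matching of the subsets of the generators: the subset `n` is matched with
the subset which differs from it in the tabulated element. -/
def flipTable : ℕ → ℕ
  | 2 => 3041594795046867071488593533162867405859048089461921219980000300145964477243947867697368905468451758225904432805421431164120094680908115179182701104497371800662502639402203488731837766575668779155534125327409225379630127595534964779861390365807813284505171702487409845708635152048705307986704981770707598088385896617989052227221760497370543664100514648503095386192639427329127511404465307304703608140125437603244138573984363473637710935791932577101662146675129823965913955763602516673066860879993642526426585536086404655275419122322265857585657014558443051978257216059140888204644592138487581063275734623040762557319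
  | 3 => 223444265389472535145751145246398989000595328179978473485329699695639969242725757122346154503171280655601132365085995622387628867963435270921942958988904783170651071326961596000852200482039483704791446652890819956060367238670487240012841813353460744428279294687020201268411848792897261979486736132078911255251317695675413612217913679839129473250472835075190268499515141356537731703288642031202439303951460346050145085719182386927034789189758455757692509714277790535361259401019644429334126381523187537643255370195274593772412172991750232391458273396913226676146249915207657052077351603851815811378226230151157527
  | 4 => 762825496789733988554756067053048238361323724395442539082053881462729344833689482504654784092068904776981564016678367060691055940593882565120287410540779435877551300622955849305114756291820055028980661579383718222889660096501914534829336455039158006959174751835910888507253172188673435574741736966664000712539023005296743391840399832171985665737260112826225517783072100227006352224561347709348965964645508763219008041953043423164391128737824123371356350564247653741478340546622623045609594423824548352237441971084199240078452499378362072035820304744393181241324874040424525730452808740006690346967993168712532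
  | 5 => 11176297930132838457359942184951324459599722745373775105793517810775217264135962848544587706284646066971981288098382917316320132233990055487546434536263613726666278648572052189173393267426548483455247623535191049650512542947038053368223235810832674148470124807036084526989016148264808299815094578746097249722170715705072375849420915385869374814850933491888970023297587504645229181122826447769924787162346158566704135831158978142186356816236074859836778913775463753025376858714673230759397403826429888587380173413321930429091239088910560573785984978120880054557346870083990115847569694217303915958978174546998970041412
  | 6 => 98238427044189521482065243869617461426910261423698533333331072158406548090518809473089213497933247505586269365209172593119781658606959249351029657356509148252624597579269989238743399477632901431439950667089928362478506173492297452166477955881913966868582015518453511336859172825181795155303715579546682088461091102883414478792214276656787298854134002532263238639385400845252988746198535162835489310354094225333499028962897597469530996704334939366547329887075427803732143915338908422146690288551500946043913323415314759652552336570661911515842551112756486528667053506384041471003952453360568900031499468956565589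
  | 7 => 2281262309111442019579165894040191326085491013232692196925799774577751092782269286820372938365751602686376264541711570715825188353062211594084360803522481717335380888733190428729057145499984002734214784437963915125934943971057603874569687248989754222661254892033769627694539675706358195035790460496925292442478944937253958253192042693448245950297360940753885286028417205534973557989102267572422670141209982795779993693165662292225266677184116337376320005832429377222575829806126586708809313613981812905783115541185979237985740029275447866656735203894718505493776129538655520896494276442774523106018454259769841960550
  | 8 => 66571388100621691965444414185007322911140532154442446846784614595476596313512803247044160720087546227333968471247251336643270344221968958946432559441011903314834149849672021298769726407995429916625982427297284008876691550715315809888549747084996380563197301476420434912057350699792967070628173143484009786688910325174638515219508216108645530349673075573795565082619735591186339407710870916254537382336829262874853246842326930164858781158597317982471849113486228979830819261968982776428769970310841978978999113628149318237193260675699455146646714251153836301094284043904890486652855033817202430195533866729553156230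
  | 9 => 42112564963250229004354032189730264350260950347339912127275530954299732114773961500037731423999396986880676820133329130768678428343130982028337089310076231550386610684915094921540987109873453759340146368748117529437935248340906035530162094425748131925370026303648723111870581204890237228899965220352238442324852786751066388757111132260351373278017774532114598290030107287586810628865222786798941167696436041509281461490187376875782714645489182932822021168977532870443567670188429755825626513721025708410665207100310498707933816621796278018785563619074764493437790756617349337797641874940629889141049349218365739281
  | 10 => 32874558613727173946763791491569274418555686205202100154880836980161075671055451681060804786965044602628604044157259095378310825018952454096719481122297295985642956245389330674434286915886015568161036487650829320740340061405633998573227720866434715087126721157383002157952139209179018865684148895095874389889959311777782480631933355562755142389689253915285297957888230335130742038950373785847136908837960513239653097627439337760313552622064837923801239252749706458118153558061298968369910432022254976638599371484721885745814896223739432546873886349975978878043870594222602327347174529855111922993889015124533585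
  | 12 => 162213293189254250599254630815737925941465051121004041422775567522061606679500700280426975399094539043132252711022533198170060455842431001513946054322570636162914006863043640386789439030213271624551738810320254417141924818547579534770707997710867900164269749885666266599221575867418946918148582719802242750952101834233375350926824439458759280646554402266947718363904633719947443187371406270613902538896476317953507088499751197479808103097239879428887317344580982429665140665166378884120982968543878400313132271084102133451533915884653843214700813573156833490366727040280398603718186387325558096539092661492519956
  | 14 => 17196153690810261768586028758486289313874753680100393165871231075986970655874930879629061743668517643117932413733754302198285837986697557383432087710711382846624237700779896356398588020513033926171469134673513185679249738827214027866990978825222164507638545679687213087171617585163399225608765930820585449056985480198404038117443195628806887888865173480097981115009806448925625282413328708907318319409034742697210012737346238741773393864652189788054032920637707525559734493825705939479303481729970981748902955781260685029367067502462472326879589929783706722874104992053219202338649123196759258875956179329565979915094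
  | 15 => 32875064344077474676068491583464417771173632192607488998232561224440399980994707074253823395361148256968085023510327882615534609096997296448442570087415135862228111016592614900324501190568536460017895992835268798428946335409203264557308385907928592006706435322293253206866207020146926399945463355583939881389919325060775615971020564819461486444146219387428600051205809075667374733223019251675283698329782016674897963020719822947091111475163951036901724360230023518434246173429793789992317714558779605647248273115208610377351092054958497289687061984185615290550973081751750273380707366658092180768870092175267398
  | 18 => 336636087134365180850769346639963333184903045969226172430546545804596035498664014056876778175219257878963309843180304883113044893289037521907359254715320636938857996470934516703716070405628422771372646904834038547395542705720976795338650944837162954183884595754939022673207481308063212694516579086153050773235864275102002320053488475365121704126033810384617862891995052127479655404302716414011857979230964251105338922822145792549163414496321879113580669617463797249074418484183577333628131112894829272923629634879658318999289278352339010157077671492190625826710264658268977775244806261813869373030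
  | 20 => 32875064344077474676068491583464417771173632192607488998232561224440399980994707074253823395361148256968085023510327882615534609096997296448442570087415135862228111016592614900324501190568536460017895992835268798428946335409203264557308385907928592006706435322293253206866207020146926399945463355583939881389919325060775615971020564819461486444146219387428600051205809075667374733223019251675283698329782016674897963020719822947091111475163951036901724360230023518434246173429793789992317714558779605647248273115208610377351092054958497289687061984185615290550973081751750273380707366658092180768870092175267398
  | 24 => 32875064344077474676068491583464417771173632192607488998232561224440399980994707074253823395361148256968085023510327882615534609096997296448442570087415135862228111016592614900324501190568536460017895992835268798428946335409203264557308385907928592006706435322293253206866207020146926399945463355583939881389919325060775615971020564819461486444146219387428600051205809075667374733223019251675283698329782016674897963020719822947091111475163951036901724360230023518434246173429793789992317714558779605647248273115208610377351092054958497289687061984185615290550973081751750273380707366658092180768870092175267398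
  | 30 => 32875064344077474676068491583464417771173632192607488998232561224440399980994707074253823395361148256968085023510327882615534609096997296448442570087415135862228111016592614900324501190568536460017895992835268798428946335409203264557308385907928592006706435322293253206866207020146926399945463355583939881389919325060775615971020564819461486444146219387428600051205809075667374733223019251675283698329782016674897963020719822947091111475163951036901724360230023518434246173429793789992317714558779605647248273115208610377351092054958497289687061984185615290550973081751750273380707366658092180768870092175267398
  | _ => 0

/-- Rank functions exhibiting the matchings as acyclic. -/
def rankTable : ℕ → ℕ
  | 2 => 120390229192789671200196730675808906407818667058242898547899691758329876292715613614162982065959656426228825608301925107942014765033909877461066028685612959068492182467494011685282612918750255802811512712596297969026475122632055910924461085957855911766535544472972189279095319117455689892644123552538164472672279586364432920063314790652234062102042058215753956360285291689200844640027292291768542960856545292847278364464808530942807181905244117170794685308849818018342353223076592661676213340749351031529490898126947424580577583475632089224142114481497563271317283680853498374817476114143448803349870623806480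
  | 3 => 15078630080462099612125779493337279211054878231655379886821099771097459415561336728255954131304714510669682538375982000320518442847867033181841006915921596158930861061911579631232303874154103427659111544878736044103621237403331526291179119231144939766612331868547546102967660306963797836564943867509276629263784250450730179168529823669837328117152467117602124485614693226174562571072373315967566004599725463772490260401484155167468342974228782730405825657955315197196791386798513649134449012132451641814864553002773015708344309284483145394706747094195531330215695770529150887641966301413441965426341528535056
  | 4 => 986236757777409366014951211810644907207941627132244533613344620149096904265830563172787561479943579773277208030058972812133649392091783603929023434938575169003212901775686746555861655828431388005868018456378608006783835776519991097039746801563758111895578960154510373172092162510946823893821099492714097511581856670373955765119898507774559099869213185916657862957111042223344014814199697294436979478707168243001406764793339689842016837957704829264233689052550154744819783691697413089474258788168857482368222413635385521927908667717867565128875621499416438916580695805787325123126027892407499188958239421827727888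
  | 5 => 84091603670835061505300560801084756903322916980055009045933289239504756324521966274766670216429673633413341387454622510078453081346851596123661182816791419162297499614312031329135752115321007640789044787615248761133342326082417529864963226347765439853635429389078045905002523050704474440990499049113214797822903348600957758890683154549347512234658051353491600345151916545033337546493604034467373167166210642254493352168546414118580515949878910171262828272816307633794535656651643078819227036437861324561141355063744322738464990997356985515260646839092756572956586085361837353587046676968143862169600
  | 6 => 15107686276800690666210910086798759065521995500639702186807996472185094256083867561087578717500501698082329282436252035656685945384706639627504630969549105749671119973401327933105989974086076871233043234416127177167385002055970545796463927616544355216943712513336401324766011259676157387479779803123738709950134309255576369520476868182715566797670014297444341046339182114522330699941865829809574881425387210305121215243568506859560790271013778058736367318296487007006605774882795440525451853341732572071863687938718710081954679957612255131124005758015462448802487740796258528596432292662540910322429011689728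
  | 7 => 15052459960518322151213295231674052973416521646309331015649005932106763615674385699600100330046017202036583359346883854710274026788432462337127325584905155167506406579138185401552571367837940709114891862233598469519374143154111963057108931584797544217961412595802859464131162923187759093349799263319081184554716576793818333377316228732927737217199600499843532345784388993962009392681775058368254070751549716483000044512033987592894359991235884961872062188283665946004168051848941376405590445730926662565995944725343893552238713829070387316180876363244969684076820549153497308985142262488659019684235451576320
  | 8 => 896977105891855103915861511761971270550094302737070640377533356724995269587884582309568584861772612309725671937792360418534627383946895249622202994339766627524234723860369516763557989747850622803914119049671615856487675842328353448769648598834585212853331948167669223527438208985724415188003877605742658438504493332750951785119989515005539806557974927853417885365957098208239666754570206104999761065788667984578407220635487520920138280624272728849204052716893017974341965813283243600986623990484859588577607147324176408456855200157592896381637114868143716950716816558178899451710389489484068270649888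
  | 9 => 448502239625955281953048533532791095045299415919973420298471041323215463906236910559469386704117583986804542316560130013170086950313251564335272426887338685561499552018786177716159514765483005653424475444814583847472891824560070571887375826250264865365852745821999388108860412928823756411381721720951795086352181532697694704082278040996976446498130308125690309047594898731979532413367982796215314433094919738044581369617536602038454950768325002483431287892011394186413278950520286972289502211430898719195061933127810780692272258700399462154895430516161090402035502440691836171516541949217841240735744
  | 10 => 1479370189003303453799853109052508813274003962095672906602469808433463581729238762087719312417311939846543250628395163327041968558268356668822137999914367508583513317264771495408967164144100208144342985298202657325719176736300758729704067043319886460455507607785520402704888149812527691991036639313463312751853717443020290072620735695770810079153362652145287594350959357559636070933083311546033330798717275381868786719837096092046070497917566840611563653188734202772181879285207480465959007963138741404245926511703860794174084412199473270883645071514911933438530934720694342032745294438206574454813877413258207264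
  | 12 => 1479355136320999479708017426544339841989994782893940177552805798234858669344276382105827225671235291955309408886228411317458018698783502528498064645568173003423108370163922340956875594906525745520676949497856231346403842694573252216908674271287290367897480851136479263261560227157829535472510637415248991611204980850248730707774391532834100080260313777651717292444625388858740159553085706288172471316740508569526591230564926836890684637001332276686443626448732842663811990351945466525055032358609477989916951321386438122663029008891195472718887515219000252967105434956049460362807726216147041764956128616061796368
  | 14 => 8521282507330107909142251565590479962942277438193829625933228263648343427533096064178287848244907770003890681233346992402044069630325784853381217911336433129249764259472402147089616736926624526002287809807238220314467435210908553473046888194250000999984089256362919044610528425679513572599659379450814099577110578732520665714601033655451983109697461372357209099113988813600691396271950418957300925807456934082306974375311241392221702418006349772920144921032644201267753776540990760367588867515848946132205303795216242547830258497653994076700316295241612849444319714973797840305881061344612220441538832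
  | 15 => 1479641063117133317022124517367029377245690256817718987405493728724049733787868850300445536546317612835420493255370781341138286844804360429653234136420247465194522013446158520590375816182672064251825034839401915344102686614722061232018475125708906556146841022975899877550269841421068972119298093882890319176826312533456493991911539771027607690912305983130797301353141115849811826864173419765157918788580858607209905965995525056245492156054156293181364865719819786237492562040315714834110422495577991660393209474459032085231621380030630342174286702202207330517805817389483060799889444295121420620944661925336264720
  | 18 => 3882614628066489793407228240772384353047362917009293607840283985906052707359828191727687507423941218130654335369172368791024871415621432205896510744819705218025562774869611849971159445409943463306577805735055487107362942411537141317263622649110636707808532822193159885462960366673131804237786353842827124915171871437580162685034317647204670709190974265398947537670504192152939118328391951099908795390968934020684047879194696540445710695566132264442424706769858131389090141469119714302113920585939407836865705015340476298976489266763876158474465658086328844028103350490166903436995805246835843122536549633294336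
  | 20 => 1479641063117133317022124517367029377245690256817718987405493728724049733787868850300445536546317612835420493255370781341138286844804360429653234136420247465194522013446158520590375816182672064251825034839401915344102686614722061232018475125708906556146841022975899877550269841421068972119298093882890319176826312533456493991911539771027607690912305983130797301353141115849811826864173419765157918788580858607209905965995525056245492156054156293181364865719819786237492562040315714834110422495577991660393209474459032085231621380030630342174286702202207330517805817389483060799889444295121420620944661925336264720
  | 24 => 1479641063117133317022124517367029377245690256817718987405493728724049733787868850300445536546317612835420493255370781341138286844804360429653234136420247465194522013446158520590375816182672064251825034839401915344102686614722061232018475125708906556146841022975899877550269841421068972119298093882890319176826312533456493991911539771027607690912305983130797301353141115849811826864173419765157918788580858607209905965995525056245492156054156293181364865719819786237492562040315714834110422495577991660393209474459032085231621380030630342174286702202207330517805817389483060799889444295121420620944661925336264720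
  | 30 => 1479641063117133317022124517367029377245690256817718987405493728724049733787868850300445536546317612835420493255370781341138286844804360429653234136420247465194522013446158520590375816182672064251825034839401915344102686614722061232018475125708906556146841022975899877550269841421068972119298093882890319176826312533456493991911539771027607690912305983130797301353141115849811826864173419765157918788580858607209905965995525056245492156054156293181364865719819786237492562040315714834110422495577991660393209474459032085231621380030630342174286702202207330517805817389483060799889444295121420620944661925336264720
  | _ => 0

/-- The chains associated with the lower cells, where they are not just the matched cells. -/
def specialChain : ℕ → ℕ → Option (List (ℤ × ℕ))
  | 4, 424 => some [(1, 440), (-1, 185), (1, 313)]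
  | 5, 474 => some [(1, 475), (-1, 471), (-1, 477), (1, 463)]
  | _, _ => none

/-- The lower cells in degree `k` whose weight differs from that of the matched cell. -/
def barList : ℕ → List (ℕ × ℕ)
  | 0 => [(2, 0)]
  | 4 => [(4, 424)]
  | 6 => [(5, 474), (8, 497)]
  | 7 => [(2, 253), (2, 254), (3, 382), (4, 508), (5, 254), (8, 253), (9, 443), (14, 501)]
  | _ => []

/-- A test for a facet `t` of the cell matched with the lower cell `n`. -/
def faceTest (E F K n t : ℕ) : Bool :=
  Nat.ble (entry E t) (entry E n) &&
    (Nat.beq ((t >>> entry F t) % 2) 1 || Nat.blt (entry K t) (entry K n))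

/-- A test for the lower cell `n` to be matched with the cell obtained by adding `f`. -/
def lowerTest (d E F K n f : ℕ) : Bool :=
  (Nat.beq (entry E (n ^^^ 2 ^ f)) (entry E n) ||
    (Nat.beq (entry E (n ^^^ 2 ^ f)) (entry E n + 1) &&
      (barList ((List.range 9).countP fun s => Nat.beq ((n >>> s) % 2) 1)).contains (d, n))) &&
  ((specialChain d n).isSome || (List.range 9).all fun s =>
    Nat.beq s f || (Nat.beq ((n >>> s) % 2) 0 || faceTest E F K n ((n ^^^ 2 ^ f) ^^^ 2 ^ s)))

/-- A test for the matching at `n`. -/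
def cellTest (d E F K n f : ℕ) : Bool :=
  Nat.ble (entry E n) 8 && Nat.ble f 8 && Nat.beq (entry F (n ^^^ 2 ^ f)) f &&
    (Nat.beq ((n >>> f) % 2) 1 || lowerTest d E F K n f)

lemma cellTest_eq_true : (indices.all fun d => (List.range 512).all fun n =>
    cellTest d (expTable d) (flipTable d) (rankTable d) n (entry (flipTable d) n)) = true := by
  decide +kernel

/-! ### Encoding of subsets -/

lemma subset_injOn {m n : ℕ} (hm : m < 512) (hn : n < 512) (h : subset m = subset n) : m = n := by
  refine Nat.eq_of_testBit_eq fun i => ?_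
  by_cases hi : i < 9
  · have := Finset.ext_iff.1 h ⟨i, hi⟩
    simp only [mem_subset] at this
    exact Bool.eq_iff_iff.2 this
  · have h2 : 512 ≤ 2 ^ i := by
      calc 512 = 2 ^ 9 := by norm_num
        _ ≤ 2 ^ i := Nat.pow_le_pow_right (by norm_num) (by omega)
    rw [Nat.testBit_lt_two_pow (hm.trans_le h2), Nat.testBit_lt_two_pow (hn.trans_le h2)]

lemma exists_subset_eq (σ : Finset (Fin 9)) : ∃ n < 512, subset n = σ := by
  have hb : Function.Bijective fun n : Fin 512 => subset n := by
    rw [Fintype.bijective_iff_injective_and_card]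
    exact ⟨fun m n h => Fin.ext (subset_injOn m.2 n.2 h), by simp⟩
  obtain ⟨n, hn⟩ := hb.2 σ
  exact ⟨n, n.2, hn⟩

/-- The number encoding a subset of the generators. -/
noncomputable def code (σ : Finset (Fin 9)) : ℕ := (exists_subset_eq σ).choose

lemma code_lt (σ : Finset (Fin 9)) : code σ < 512 := (exists_subset_eq σ).choose_spec.1

lemma subset_code (σ : Finset (Fin 9)) : subset (code σ) = σ :=
  (exists_subset_eq σ).choose_spec.2

lemma code_subset {n : ℕ} (hn : n < 512) : code (subset n) = n :=
  subset_injOn (code_lt _) hn (subset_code _)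

lemma testBit_code {σ : Finset (Fin 9)} {i : Fin 9} : (code σ).testBit i ↔ i ∈ σ := by
  rw [← mem_subset, subset_code]

lemma code_injective : Function.Injective code := fun σ τ h => by
  rw [← subset_code σ, h, subset_code]

lemma xor_two_pow_lt {n : ℕ} (hn : n < 512) (s : Fin 9) : n ^^^ 2 ^ (s : ℕ) < 512 :=
  Nat.xor_lt_two_pow (n := 9) hn (Nat.pow_lt_pow_right (by norm_num) s.2)

lemma subset_xor (n : ℕ) (s : Fin 9) : subset (n ^^^ 2 ^ (s : ℕ)) = symmDiff (subset n) {s} := by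
  ext i
  simp only [mem_subset, Finset.mem_symmDiff, Finset.mem_singleton, Nat.testBit_xor,
    Nat.testBit_two_pow, Fin.ext_iff]
  by_cases h : (s : ℕ) = i
  · simp [h]
  · simp [h, Ne.symm h]

lemma code_symmDiff (σ : Finset (Fin 9)) (s : Fin 9) :
    code (symmDiff σ {s}) = code σ ^^^ 2 ^ (s : ℕ) := by
  rw [← code_subset (xor_two_pow_lt (code_lt σ) s), subset_xor, subset_code]

lemma erase_eq_symmDiff {σ : Finset (Fin 9)} {s : Fin 9} (h : s ∈ σ) :
    σ.erase s = symmDiff σ {s} := by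
  ext i
  simp only [Finset.mem_erase, Finset.mem_symmDiff, Finset.mem_singleton]
  by_cases hi : i = s
  · simp [hi, h]
  · simp [hi]

lemma code_erase {σ : Finset (Fin 9)} {s : Fin 9} (h : s ∈ σ) :
    code (σ.erase s) = code σ ^^^ 2 ^ (s : ℕ) := by
  rw [erase_eq_symmDiff h, code_symmDiff]

lemma card_symmDiff_singleton {σ : Finset (Fin 9)} {s : Fin 9} (h : s ∉ σ) :
    (symmDiff σ {s}).card = σ.card + 1 := by
  have : symmDiff σ {s} = insert s σ := by
    ext i
    simp only [Finset.mem_insert, Finset.mem_symmDiff, Finset.mem_singleton]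
    by_cases hi : i = s
    · simp [hi, h]
    · simp [hi]
  rw [this, Finset.card_insert_of_notMem h]

/-! ### The boundary of a simplex -/

/-- The incidence number of two subsets of the generators. -/
def incidence (σ τ : Finset (Fin 9)) : ℤ :=
  ∑ s ∈ σ, if τ = σ.erase s then (-1) ^ (σ.filter (· < s)).card else 0

lemma incidence_ne_zero {σ τ : Finset (Fin 9)} (h : incidence σ τ ≠ 0) :
    ∃ s ∈ σ, τ = σ.erase s := by
  obtain ⟨s, hs, hne⟩ := Finset.exists_ne_zero_of_sum_ne_zero h
  exact ⟨s, hs, by_contra fun h' => hne (if_neg h')⟩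

lemma incidence_erase {σ : Finset (Fin 9)} {s : Fin 9} (hs : s ∈ σ) :
    incidence σ (σ.erase s) = (-1) ^ (σ.filter (· < s)).card := by
  rw [incidence, Finset.sum_eq_single_of_mem s hs, if_pos rfl]
  intro t _ hts
  rw [if_neg fun h => hts ?_]
  exact (Finset.erase_injOn σ (by simpa using hs) (by simpa) h).symm

lemma incidence_comp_aux {σ : Finset (Fin 9)} {s t : Fin 9} (hs : s ∈ σ) (ht : t ∈ σ)
    (hst : s < t) : incidence σ (σ.erase s) * incidence (σ.erase s) ((σ.erase s).erase t) =
      - (incidence σ (σ.erase t) * incidence (σ.erase t) ((σ.erase t).erase s)) := by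
  rw [incidence_erase hs, incidence_erase ht,
    incidence_erase (Finset.mem_erase.2 ⟨hst.ne', ht⟩),
    incidence_erase (Finset.mem_erase.2 ⟨hst.ne, hs⟩)]
  have h1 : (σ.erase t).filter (· < s) = σ.filter (· < s) := by
    ext i
    simp only [Finset.mem_filter, Finset.mem_erase]
    exact ⟨fun h => ⟨h.1.2, h.2⟩, fun h => ⟨⟨(h.2.trans hst).ne, h.1⟩, h.2⟩⟩
  have h2 : (σ.filter (· < t)).card = ((σ.erase s).filter (· < t)).card + 1 := by
    rw [Finset.filter_erase, Finset.card_erase_add_one]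
    simp [hs, hst]
  rw [h1, h2, pow_succ]
  ring

lemma incidence_mul_incidence :
    (Matrix.of incidence * Matrix.of incidence : Matrix _ _ ℤ) = 0 := by
  ext σ τ
  rw [Matrix.mul_apply, Matrix.zero_apply]
  simp only [Matrix.of_apply]
  have key (σ : Finset (Fin 9)) (f : Finset (Fin 9) → ℤ) :
      ∑ ρ, incidence σ ρ * f ρ = ∑ s ∈ σ, incidence σ (σ.erase s) * f (σ.erase s) := by
    simp only [incidence.eq_1 σ, Finset.sum_mul, ite_mul, zero_mul]
    rw [Finset.sum_comm]
    refine Finset.sum_congr rfl fun s hs => ?_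
    rw [Finset.sum_ite_eq' Finset.univ, if_pos (Finset.mem_univ _), ← incidence_erase hs]
    simp only [incidence, Finset.sum_mul, ite_mul, zero_mul]
  have key' (ρ : Finset (Fin 9)) : incidence ρ τ =
      ∑ t ∈ ρ, incidence ρ (ρ.erase t) * (if ρ.erase t = τ then 1 else 0) := by
    rw [← key ρ fun ρ => if ρ = τ then 1 else 0]; simp
  rw [key]
  simp only [key', Finset.mul_sum]
  rw [Finset.sum_sigma']
  refine Finset.sum_involution (fun x _ => ⟨x.2, x.1⟩) ?_ ?_ ?_ ?_
  · rintro ⟨s, t⟩ h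
    simp only [Finset.mem_sigma, Finset.mem_erase] at h
    obtain ⟨hs, hts, ht⟩ := h
    simp only
    rw [Finset.erase_right_comm (a := t) (b := s), ← mul_assoc, ← mul_assoc, ← add_mul]
    rcases lt_or_gt_of_ne hts with h | h
    · have h' := incidence_comp_aux ht hs h
      rw [Finset.erase_right_comm (a := t) (b := s)] at h'
      rw [h']
      simp
    · have h' := incidence_comp_aux hs ht h
      rw [Finset.erase_right_comm (a := t) (b := s)] at h'
      rw [h']
      simp
  · rintro ⟨s, t⟩ h _ heq
    simp only [Finset.mem_sigma, Finset.mem_erase] at h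
    simp only [Sigma.mk.injEq, heq_eq_eq] at heq
    exact h.2.1 heq.1
  · rintro ⟨s, t⟩ h
    simp only [Finset.mem_sigma, Finset.mem_erase] at h ⊢
    exact ⟨h.2.2, h.2.1.symm, h.1⟩
  · rintro ⟨s, t⟩ _
    rfl

/-! ### The local Morse data -/

/-- The element added to or removed from the subset encoded by `n` by the matching. -/
def flip (d n : ℕ) : ℕ := entry (flipTable d) n

/-- The number encoding the subset matched with the one encoded by `n`. -/
def mateCode (d n : ℕ) : ℕ := n ^^^ 2 ^ flip d n

/-- The rank of the lower cell encoded by `n`. -/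
def rank (d n : ℕ) : ℕ := entry (rankTable d) n

/-- The chain associated with the lower cell encoded by `n`. -/
def chainList (d n : ℕ) : List (ℤ × ℕ) := (specialChain d n).getD [(1, mateCode d n)]

/-- The coefficient of a chain at the cell encoded by `m`. -/
def coeff (l : List (ℤ × ℕ)) (m : ℕ) : ℤ := (l.map fun p => if p.2 = m then p.1 else 0).sum

/-- The incidence number of the subsets encoded by `n` and `m`. -/
def faceCoeff (n m : ℕ) : ℤ :=
  ∑ s : Fin 9, if n.testBit s ∧ m = n ^^^ 2 ^ (s : ℕ) then
    (-1) ^ (Finset.univ.filter fun t : Fin 9 => n.testBit t ∧ t < s).card else 0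

/-- The coefficient of the boundary of a chain at the cell encoded by `m`. -/
def boundaryCoeff (l : List (ℤ × ℕ)) (m : ℕ) : ℤ := (l.map fun p => p.1 * faceCoeff p.2 m).sum

/-- The conditions on the exceptional chains. -/
def SpecialCorrect (d n : ℕ) (l : List (ℤ × ℕ)) : Prop :=
  (∀ p ∈ l, p.2 < 512 ∧ p.2.testBit (flip d p.2) ∧ expo d p.2 ≤ expo d (mateCode d n) ∧
    (subset p.2).card = (subset n).card + 1 ∧
    (p.2 = mateCode d n ∨ specialChain d (mateCode d p.2) = none)) ∧
  coeff l (mateCode d n) = 1 ∧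
  (∀ m < 512, boundaryCoeff l m = 0 ∨ (expo d m ≤ expo d n ∧
    (m.testBit (flip d m) ∨ m = n ∨ rank d m < rank d n))) ∧
  boundaryCoeff l n * boundaryCoeff l n = 1

instance (d n : ℕ) (l : List (ℤ × ℕ)) : Decidable (SpecialCorrect d n l) := by
  unfold SpecialCorrect; infer_instance

lemma specialCorrect_four :
    SpecialCorrect 4 424 [(1, 440), (-1, 185), (1, 313)] := by decide +kernel

lemma specialCorrect_five :
    SpecialCorrect 5 474 [(1, 475), (-1, 471), (-1, 477), (1, 463)] := by decide +kernel

lemma specialCorrect {d n : ℕ} {l : List (ℤ × ℕ)} (h : specialChain d n = some l) :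
    SpecialCorrect d n l := by
  unfold specialChain at h
  split at h
  · cases h; exact specialCorrect_four
  · cases h; exact specialCorrect_five
  · cases h

lemma shiftRight_mod_two_eq {n s : ℕ} : (n >>> s) % 2 = 1 ↔ n.testBit s := by
  rw [Nat.testBit_eq_decide_div_mod_eq, Nat.shiftRight_eq_div_pow, decide_eq_true_iff]

lemma card_subset : ∀ n < 512, (subset n).card =
    (List.range 9).countP fun s => Nat.beq ((n >>> s) % 2) 1 := by
  decide +kernel

lemma cellTest_of_mem {d : ℕ} (hd : d ∈ indices) {n : ℕ} (hn : n < 512) :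
    cellTest d (expTable d) (flipTable d) (rankTable d) n (flip d n) = true :=
  List.all_eq_true.1 (List.all_eq_true.1 cellTest_eq_true d hd) n (List.mem_range.2 hn)

section Cells

variable {d : ℕ} (hd : d ∈ indices) {n : ℕ} (hn : n < 512)
include hd hn

lemma expo_le : expo d n ≤ 8 := by
  have h := cellTest_of_mem hd hn
  simp only [cellTest, Bool.and_eq_true] at h
  exact Nat.le_of_ble_eq_true h.1.1.1

lemma flip_lt : flip d n < 9 := by
  have h := cellTest_of_mem hd hn
  simp only [cellTest, Bool.and_eq_true] at h
  exact Nat.lt_succ_of_le (Nat.le_of_ble_eq_true h.1.1.2)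

lemma flip_mateCode : flip d (mateCode d n) = flip d n := by
  have h := cellTest_of_mem hd hn
  simp only [cellTest, Bool.and_eq_true] at h
  exact Nat.eq_of_beq_eq_true h.1.2

lemma lowerTest_of_not_testBit (h : ¬ n.testBit (flip d n)) :
    lowerTest d (expTable d) (flipTable d) (rankTable d) n (flip d n) = true := by
  have h' := cellTest_of_mem hd hn
  simp only [cellTest, Bool.and_eq_true, Bool.or_eq_true] at h'
  exact h'.2.resolve_left fun h1 => h (shiftRight_mod_two_eq.1 (Nat.eq_of_beq_eq_true h1))

lemma expo_mateCode (h : ¬ n.testBit (flip d n)) :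
    expo d (mateCode d n) = expo d n ∨
      expo d (mateCode d n) = expo d n + 1 ∧ (d, n) ∈ barList (subset n).card := by
  have h' := lowerTest_of_not_testBit hd hn h
  simp only [lowerTest, Bool.and_eq_true, Bool.or_eq_true, ← card_subset n hn,
    List.contains_iff_mem] at h'
  exact h'.1.imp Nat.eq_of_beq_eq_true fun h => ⟨Nat.eq_of_beq_eq_true h.1, h.2⟩

lemma face_mateCode (h : ¬ n.testBit (flip d n)) (hs : specialChain d n = none) {s : ℕ}
    (h9 : s < 9) (hsf : s ≠ flip d n) (hsn : n.testBit s) :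
    expo d (mateCode d n ^^^ 2 ^ s) ≤ expo d n ∧
      ((mateCode d n ^^^ 2 ^ s).testBit (flip d (mateCode d n ^^^ 2 ^ s)) ∨
        rank d (mateCode d n ^^^ 2 ^ s) < rank d n) := by
  have h' := lowerTest_of_not_testBit hd hn h
  simp only [lowerTest, Bool.and_eq_true, hs, Option.isSome_none, Bool.or_eq_true,
    Bool.false_eq_true, false_or, List.all_eq_true, List.mem_range, faceTest] at h'
  obtain h1 | h1 | h1 := h'.2 s h9
  · exact absurd (Nat.eq_of_beq_eq_true h1) hsf
  · have := shiftRight_mod_two_eq.2 hsn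
    rw [Nat.eq_of_beq_eq_true h1] at this
    cases this
  · exact ⟨Nat.le_of_ble_eq_true h1.1, h1.2.imp
      (fun h => shiftRight_mod_two_eq.1 (Nat.eq_of_beq_eq_true h)) Nat.le_of_ble_eq_true⟩

end Cells

lemma testBit_mateCode {d n : ℕ} : (mateCode d n).testBit (flip d n) = !n.testBit (flip d n) := by
  simp [mateCode]

lemma mateCode_mateCode {d : ℕ} (hd : d ∈ indices) {n : ℕ} (hn : n < 512) :
    mateCode d (mateCode d n) = n := by
  rw [mateCode, flip_mateCode hd hn, mateCode, Nat.xor_assoc, Nat.xor_self, Nat.xor_zero]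

lemma mateCode_lt {d : ℕ} (hd : d ∈ indices) {n : ℕ} (hn : n < 512) : mateCode d n < 512 :=
  xor_two_pow_lt hn ⟨flip d n, flip_lt hd hn⟩

lemma faceCoeff_code (σ τ : Finset (Fin 9)) : faceCoeff (code σ) (code τ) = incidence σ τ := by
  rw [faceCoeff, incidence, ← Finset.sum_filter_add_sum_filter_not Finset.univ (· ∈ σ),
    Finset.sum_eq_zero (s := Finset.univ.filter (· ∉ σ)), add_zero]
  · refine Finset.sum_congr (by simp) fun s hs => ?_
    have hs : s ∈ σ := by simpa using hs
    have h1 : (code σ).testBit s ∧ code τ = code σ ^^^ 2 ^ (s : ℕ) ↔ τ = σ.erase s := by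
      rw [testBit_code, ← code_erase hs, code_injective.eq_iff]
      exact and_iff_right hs
    have h2 : (Finset.univ.filter fun t : Fin 9 => (code σ).testBit t ∧ t < s) =
        σ.filter (· < s) := by
      ext i
      simp [testBit_code]
    simp only [h1, h2]
  · intro s hs
    rw [if_neg]
    rw [testBit_code]
    exact fun h => (Finset.mem_filter.1 hs).2 h.1

lemma sum_coeff_mul_incidence {l : List (ℤ × ℕ)} (hl : ∀ p ∈ l, p.2 < 512)
    (τ : Finset (Fin 9)) :
    ∑ σ, coeff l (code σ) * incidence σ τ = boundaryCoeff l (code τ) := by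
  induction l with
  | nil => simp [coeff, boundaryCoeff]
  | cons p l ih =>
    simp only [coeff, boundaryCoeff, List.map_cons, List.sum_cons, add_mul] at ih ⊢
    rw [Finset.sum_add_distrib, ih fun q hq => hl q (List.mem_cons_of_mem _ hq)]
    congr 1
    have hp := hl p List.mem_cons_self
    rw [Finset.sum_eq_single (subset p.2)]
    · rw [code_subset hp, if_pos rfl, ← faceCoeff_code, code_subset hp]
    · intro σ _ h
      rw [if_neg, zero_mul]
      rintro h'
      exact h (by rw [h', subset_code])
    · simp

lemma exists_mem_of_coeff_ne_zero {l : List (ℤ × ℕ)} {m : ℕ} (h : coeff l m ≠ 0) :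
    ∃ p ∈ l, p.2 = m := by
  by_contra! h'
  refine h (List.sum_eq_zero fun x hx => ?_)
  obtain ⟨p, hp, rfl⟩ := List.mem_map.1 hx
  exact if_neg (h' p hp)

lemma boundaryCoeff_singleton (n m : ℕ) : boundaryCoeff [(1, n)] m = faceCoeff n m := by
  simp [boundaryCoeff]

lemma coeff_singleton (n m : ℕ) : coeff [(1, n)] m = if m = n then 1 else 0 := by
  simp [coeff, eq_comm]

/-- The chain of a lower cell satisfies the conditions on Morse data. -/
lemma chainList_correct {d : ℕ} (hd : d ∈ indices) {n : ℕ} (hn : n < 512)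
    (h : ¬ n.testBit (flip d n)) : SpecialCorrect d n (chainList d n) := by
  rcases hs : specialChain d n with _ | l
  swap
  · rw [chainList, hs]
    exact specialCorrect hs
  rw [chainList, hs, Option.getD_none]
  obtain ⟨f, hf⟩ : ∃ f : Fin 9, (f : ℕ) = flip d n := ⟨⟨flip d n, flip_lt hd hn⟩, rfl⟩
  obtain ⟨σ, hσ⟩ : ∃ σ, code σ = n := ⟨subset n, code_subset hn⟩
  have hfσ : f ∉ σ := by rw [← testBit_code, hσ, hf]; exact h
  have hm : mateCode d n = code (symmDiff σ {f}) := by rw [code_symmDiff, hσ, hf, mateCode]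
  have hfm : f ∈ symmDiff σ {f} := by simp [Finset.mem_symmDiff, hfσ]
  have hcard := card_symmDiff_singleton hfσ
  have hback : (symmDiff σ {f}).erase f = σ := by
    rw [erase_eq_symmDiff hfm, symmDiff_symmDiff_cancel_right]
  refine ⟨?_, ?_, ?_, ?_⟩
  · rintro p hp
    obtain rfl := List.mem_singleton.1 hp
    refine ⟨mateCode_lt hd hn, ?_, le_rfl, ?_, Or.inl rfl⟩
    · rw [flip_mateCode hd hn, testBit_mateCode]
      simpa using h
    · simp only
      rw [hm, subset_code, ← hσ, subset_code, hcard]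
  · rw [coeff_singleton, if_pos rfl]
  · intro m hm'
    obtain ⟨τ, rfl⟩ : ∃ τ, code τ = m := ⟨subset m, code_subset hm'⟩
    rw [boundaryCoeff_singleton, hm, faceCoeff_code, or_iff_not_imp_left]
    intro h0
    obtain ⟨s, hs', rfl⟩ := incidence_ne_zero h0
    by_cases hsf : s = f
    · rw [hsf, hback, hσ]
      exact ⟨le_rfl, Or.inr (Or.inl rfl)⟩
    · have hsσ : s ∈ σ := by simpa [Finset.mem_symmDiff, hsf] using hs'
      rw [code_erase hs', ← hm]
      have := face_mateCode hd hn h hs s.2 (by rw [← hf]; exact Fin.val_ne_of_ne hsf)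
        (by rw [← hσ]; exact testBit_code.2 hsσ)
      exact ⟨this.1, this.2.imp_right Or.inr⟩
  · rw [boundaryCoeff_singleton, hm, ← hσ, faceCoeff_code]
    have h1 := incidence_erase hfm
    rw [hback] at h1
    rw [h1, ← pow_add, ← two_mul, pow_mul]
    simp

/-- The local Morse data of the affine Coxeter group of type `E₈`. -/
noncomputable def morseData {d : ℕ} (hd : d ∈ indices) :
    MorseData (Matrix.of incidence) Finset.card (fun σ => expo d (code σ)) where
  lower σ := ¬ (code σ).testBit (flip d (code σ))
  mate σ := subset (mateCode d (code σ))
  rk σ := rank d (code σ)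
  Y := Matrix.of fun σ τ => if (code σ).testBit (flip d (code σ)) then 0 else
    coeff (chainList d (code σ)) (code τ)
  Y_of_not_lower := fun a b h => by
    rw [Matrix.of_apply, if_pos (not_not.1 h)]
  diag_mul_diag := fun a ha => by
    have h := chainList_correct hd (code_lt a) ha
    rw [Matrix.mul_apply]
    simp only [Matrix.of_apply, if_neg ha]
    rw [sum_coeff_mul_incidence fun p hp => (h.1 p hp).1]
    exact h.2.2.2
  of_boundary := fun a t ha hne => by
    have h := chainList_correct hd (code_lt a) ha
    rw [Matrix.mul_apply] at hne
    simp only [Matrix.of_apply, if_neg ha] at hne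
    obtain ⟨b, -, hb⟩ := Finset.exists_ne_zero_of_sum_ne_zero hne
    rw [sum_coeff_mul_incidence fun p hp => (h.1 p hp).1] at hne
    obtain ⟨h1, h2⟩ := (h.2.2.1 _ (code_lt t)).resolve_left hne
    refine ⟨h1, ?_, fun hl hta => ?_⟩
    · obtain ⟨p, hp, hpb⟩ := exists_mem_of_coeff_ne_zero (left_ne_zero_of_mul hb)
      obtain ⟨s, hs, rfl⟩ := incidence_ne_zero (right_ne_zero_of_mul hb)
      have h3 := (h.1 p hp).2.2.2.1
      rw [hpb, subset_code, subset_code] at h3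
      rw [Finset.card_erase_of_mem hs, h3, Nat.add_sub_cancel]
    · exact (h2.resolve_left hl).resolve_left fun h => hta (code_injective h)
  of_Y := fun a b ha hne => by
    have h := chainList_correct hd (code_lt a) ha
    simp only [Matrix.of_apply, if_neg ha] at hne
    obtain ⟨p, hp, hpb⟩ := exists_mem_of_coeff_ne_zero hne
    obtain ⟨-, h1, h2, h3, -⟩ := h.1 p hp
    rw [hpb] at h1 h2 h3
    rw [subset_code, subset_code] at h3
    exact ⟨not_not.2 h1, by rwa [code_subset (mateCode_lt hd (code_lt a))], h3⟩
  of_not_lower := fun b hb => by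
    have h := not_not.1 hb
    have hm := mateCode_lt hd (code_lt b)
    rw [code_subset hm, flip_mateCode hd (code_lt b), testBit_mateCode, h,
      mateCode_mateCode hd (code_lt b)]
    exact ⟨by simp, subset_code b⟩
  Y_mate := fun a ha => by
    have h := chainList_correct hd (code_lt a) ha
    rw [Matrix.of_apply, if_neg ha, code_subset (mateCode_lt hd (code_lt a))]
    exact h.2.1
  Y_mate_of_Y := fun a b c ha hne hb => by
    have h := chainList_correct hd (code_lt a) ha
    simp only [Matrix.of_apply, if_neg ha] at hne
    obtain ⟨p, hp, hpb⟩ := exists_mem_of_coeff_ne_zero hne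
    obtain ⟨-, h1, -, -, h4⟩ := h.1 p hp
    rw [hpb] at h1 h4
    have h5 := h4.resolve_left fun h' => hb (by rw [← h', subset_code])
    rw [Matrix.of_apply, code_subset (mateCode_lt hd (code_lt b)), chainList, h5,
      Option.getD_none, mateCode_mateCode hd (code_lt b), coeff_singleton,
      flip_mateCode hd (code_lt b), testBit_mateCode, h1]
    simp [code_injective.eq_iff]

/-! ### The weights of the simplices -/

lemma monotone_test : (indices.all fun d => (List.range 512).all fun n => (List.range 9).all fun s =>
    Nat.beq ((n >>> s) % 2) 0 ||
      Nat.ble (entry (expTable d) (n ^^^ 2 ^ s)) (entry (expTable d) n)) = true := by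
  decide +kernel

lemma expo_erase_le {d : ℕ} (hd : d ∈ indices) {σ : Finset (Fin 9)} {s : Fin 9} (hs : s ∈ σ) :
    expo d (code (σ.erase s)) ≤ expo d (code σ) := by
  have h := List.all_eq_true.1 (List.all_eq_true.1 (List.all_eq_true.1 monotone_test d hd)
    (code σ) (List.mem_range.2 (code_lt σ))) s (List.mem_range.2 s.2)
  rw [Bool.or_eq_true] at h
  rw [code_erase hs]
  refine Nat.le_of_ble_eq_true (h.resolve_left fun h => ?_)
  have := shiftRight_mod_two_eq.2 (testBit_code.2 hs)
  rw [Nat.eq_of_beq_eq_true h] at this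
  cases this

lemma nodup_indices : indices.Nodup := by decide

lemma cyc_ne_zero (d : ℕ) : cyc d ≠ 0 := by
  rw [cyc, map_ne_zero_iff _ toLaurent_injective]
  exact cyclotomic_ne_zero d ℚ

lemma isCoprime_cyc : Pairwise (Function.onFun IsCoprime fun p : {d // d ∈ indices} => cyc p) :=
  fun _ _ h => (cyclotomic.isCoprime_rat fun h' => h (Subtype.ext h')).map
    Polynomial.toLaurent

/-- The exponents of the weight. -/
noncomputable def exponent (p : {d // d ∈ indices}) (σ : Finset (Fin 9)) : ℕ := expo p (code σ)

/-- The weight of a subset of the generators. -/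
noncomputable def simplexWeight : Finset (Fin 9) → R :=
  totalWeight (fun p : {d // d ∈ indices} => cyc p) exponent

lemma simplexWeight_def (σ : Finset (Fin 9)) :
    simplexWeight σ = ∏ p : {d // d ∈ indices}, cyc p ^ expo p (code σ) := rfl

lemma simplexWeight_eq (σ : Finset (Fin 9)) : simplexWeight σ =
    toLaurent (indices.map fun d => cyclotomic d ℚ ^ expo d (code σ)).prod := by
  rw [map_list_prod, List.map_map, ← List.prod_toFinset _ nodup_indices,
    simplexWeight_def,
    Finset.prod_subtype (p := fun d => d ∈ indices) (F := inferInstance) _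
      fun d => List.mem_toFinset]
  simp [cyc]

lemma simplexWeight_ne_zero (σ : Finset (Fin 9)) : simplexWeight σ ≠ 0 := by
  rw [simplexWeight_def]
  exact Finset.prod_ne_zero_iff.2 fun p _ => pow_ne_zero _ (cyc_ne_zero p)

lemma simplexWeight_erase_dvd {σ : Finset (Fin 9)} {s : Fin 9} (hs : s ∈ σ) :
    simplexWeight (σ.erase s) ∣ simplexWeight σ := by
  rw [simplexWeight_def, simplexWeight_def]
  exact Finset.prod_dvd_prod_of_dvd _ _ fun p _ => pow_dvd_pow _ (expo_erase_le p.2 hs)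

lemma prod_erase_dvd {σ : Finset (Fin 9)} {s : Fin 9} (hs : s ∈ σ) :
    (indices.map fun d => cyclotomic d ℚ ^ expo d (code (σ.erase s))).prod ∣
      (indices.map fun d => cyclotomic d ℚ ^ expo d (code σ)).prod := by
  rw [← List.prod_toFinset _ nodup_indices, ← List.prod_toFinset _ nodup_indices]
  exact Finset.prod_dvd_prod_of_dvd _ _ fun d hd =>
    pow_dvd_pow _ (expo_erase_le (List.mem_toFinset.1 hd) hs)

/-- The chains of degree `k` of the unweighted complex divisible by the weights. -/
noncomputable abbrev simplexChains (k : ℕ) : Submodule R (Finset (Fin 9) → R) :=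
  MorseData.chains Finset.card simplexWeight k

/-- The boundary of chains. -/
noncomputable abbrev boundary : (Finset (Fin 9) → R) →ₗ[R] (Finset (Fin 9) → R) :=
  MorseData.act R (Matrix.of incidence)

lemma boundary_mem {k : ℕ} {x : Finset (Fin 9) → R} (hx : x ∈ simplexChains (k + 1)) :
    boundary x ∈ simplexChains k := by
  refine MorseData.act_mem_chains (fun σ τ h => ?_) hx
  obtain ⟨s, hs, rfl⟩ := incidence_ne_zero h
  refine ⟨simplexWeight_erase_dvd hs, fun h => ?_⟩
  rw [Finset.card_erase_of_mem hs, h, Nat.add_sub_cancel]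

lemma barList_correct : ∀ k < 9, (barList k).Nodup ∧ ∀ q ∈ barList k, q.1 ∈ indices ∧ q.2 < 512 ∧
    ¬ q.2.testBit (flip q.1 q.2) ∧ (subset q.2).card = k ∧
      expo q.1 (mateCode q.1 q.2) = expo q.1 q.2 + 1 := by
  decide +kernel

/-- The homology of the complex of chains divisible by the weights. -/
lemma exists_surjective_cycQuot {k : ℕ} (hk : k < 9) :
    ∃ θ : zChains (Matrix.of incidence) Finset.card simplexWeight k →ₗ[R]
        (∀ i : Fin (barList k).length, CycQuot (barList k)[i].1),
      Function.Surjective θ ∧ ∀ x, θ x = 0 ↔ ∃ u ∈ simplexChains (k + 1), boundary u = x := by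
  obtain ⟨hnd, hbar⟩ := barList_correct k hk
  have hget : ∀ i : Fin (barList k).length, (barList k)[i] ∈ barList k := fun i =>
    List.getElem_mem _
  have : Nonempty {d // d ∈ indices} := ⟨⟨2, by decide⟩⟩
  refine exists_surjective_ker (P := {d // d ∈ indices}) (v := exponent)
    (fun p => morseData p.2) incidence_mul_incidence isCoprime_cyc (fun p => cyc_ne_zero p)
    (e := 8) (fun p σ => expo_le p.2 (code_lt σ)) k
    (fun i : Fin (barList k).length =>
      (⟨(barList k)[i].1, (hbar _ (hget i)).1⟩, subset (barList k)[i].2)) ?_ ?_ ?_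
  · intro i j hij
    simp only [Prod.mk.injEq, Subtype.mk.injEq] at hij
    refine Fin.ext ((List.Nodup.getElem_inj_iff hnd).1 (Prod.ext hij.1 ?_))
    exact subset_injOn (hbar _ (hget i)).2.1 (hbar _ (hget j)).2.1 hij.2
  · intro i
    obtain ⟨hd, hlt, hl, hc, he⟩ := hbar _ (hget i)
    simp only [morseData, exponent, code_subset hlt, code_subset (mateCode_lt hd hlt)]
    exact ⟨hl, hc, he⟩
  · intro p σ hl hc he
    have hm := mateCode_lt p.2 (code_lt σ)
    simp only [morseData, exponent, code_subset hm] at hl he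
    have h := ((expo_mateCode p.2 (code_lt σ) hl).resolve_left he).2
    rw [subset_code, hc] at h
    obtain ⟨i, hi, h⟩ := List.getElem_of_mem h
    refine ⟨⟨i, hi⟩, ?_⟩
    simp only [Fin.getElem_fin, h, subset_code]

/-! ### The weighted complex -/

section Weighted

variable {M : CoxeterMatrix (Fin 9)} {W : Type*} [Group W] (cs : CoxeterSystem M W)

/-- The comparison map from the weighted complex. -/
noncomputable def comparison (k : ℕ) : (KW cs k → R) →ₗ[R] (Finset (Fin 9) → R) :=
  open Classical in
  LinearMap.pi fun σ => if h : σ.card = k ∧ (parabolic cs σ : Set W).Finite then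
    simplexWeight σ • LinearMap.proj (⟨σ, h⟩ : KW cs k) else 0

lemma comparison_apply {k : ℕ} (x : KW cs k → R) (σ : KW cs k) :
    comparison cs k x σ = simplexWeight σ * x σ := by
  simp only [comparison, LinearMap.pi_apply, dif_pos σ.2]
  rfl

lemma comparison_apply_of_not {k : ℕ} (x : KW cs k → R) {σ : Finset (Fin 9)}
    (h : ¬ (σ.card = k ∧ (parabolic cs σ : Set W).Finite)) : comparison cs k x σ = 0 := by
  simp only [comparison, LinearMap.pi_apply, dif_neg h]
  rfl

lemma comparison_injective (k : ℕ) : Function.Injective (comparison cs k) := by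
  intro x y h
  ext σ : 1
  have := congrFun h σ
  rw [comparison_apply, comparison_apply] at this
  exact mul_left_cancel₀ (simplexWeight_ne_zero _) this

lemma comparison_mem (k : ℕ) (x : KW cs k → R) : comparison cs k x ∈ simplexChains k := by
  intro σ
  by_cases h : σ.card = k ∧ (parabolic cs σ : Set W).Finite
  · exact ⟨⟨_, comparison_apply cs x ⟨σ, h⟩⟩, fun h' => absurd h.1 h'⟩
  · rw [comparison_apply_of_not cs x h]
    exact ⟨dvd_zero _, fun _ => rfl⟩

variable {cs} (hM : IsAffineE8 M)
include hM

lemma finite_iff {σ : Finset (Fin 9)} :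
    (parabolic cs σ : Set W).Finite ↔ σ ≠ Finset.univ := by
  constructor
  · rintro h rfl
    refine parabolic_univ_infinite cs hM ?_
    rwa [subset_511]
  · intro h
    have : code σ ≠ 511 := fun h' => h (by rw [← subset_code σ, h', subset_511])
    have h' := (finite_and_poin_subset cs hM (code σ) (by have := code_lt σ; omega)).1
    rwa [subset_code] at h'

lemma poin_eq {σ : Finset (Fin 9)} (hσ : (parabolic cs σ : Set W).Finite) :
    poin cs σ = (indices.map fun d => cyclotomic d ℚ ^ expo d (code σ)).prod := by
  have h := (finite_iff hM).1 hσ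
  have : code σ ≠ 511 := fun h' => h (by rw [← subset_code σ, h', subset_511])
  have h' := (finite_and_poin_subset cs hM (code σ) (by have := code_lt σ; omega)).2
  rwa [subset_code] at h'

lemma finite_erase {σ : Finset (Fin 9)} (s : Fin 9) :
    (parabolic cs (σ.erase s) : Set W).Finite := by
  rw [finite_iff hM]
  intro h
  have := Finset.mem_univ s
  rw [← h] at this
  simp at this

lemma simplexWeight_mul_bcoeff {σ : Finset (Fin 9)} (hσ : (parabolic cs σ : Set W).Finite)
    (τ : Finset (Fin 9)) :
    simplexWeight τ * bcoeff cs σ τ = simplexWeight σ * (incidence σ τ : R) := by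
  rw [bcoeff, incidence, Int.cast_sum, Finset.mul_sum, Finset.mul_sum]
  refine Finset.sum_congr rfl fun s hs => ?_
  by_cases h : τ = σ.erase s
  · subst h
    rw [if_pos rfl, if_pos rfl, simplexWeight_eq, simplexWeight_eq, ← poin_eq hM hσ,
      ← poin_eq hM (finite_erase (cs := cs) hM s)]
    have hdvd : poin cs (σ.erase s) ∣ poin cs σ := by
      rw [poin_eq hM hσ, poin_eq hM (finite_erase (cs := cs) hM s)]
      exact prod_erase_dvd hs
    have hne : poin cs (σ.erase s) ≠ 0 := by
      intro h0
      refine simplexWeight_ne_zero (σ.erase s) ?_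
      rw [simplexWeight_eq, ← poin_eq hM (finite_erase (cs := cs) hM s), h0, map_zero]
    rw [mul_left_comm, ← map_mul, EuclideanDomain.mul_div_cancel' hne hdvd, mul_comm]
    push_cast
    rfl
  · rw [if_neg h, if_neg h, Int.cast_zero, mul_zero, mul_zero]

lemma comparison_bdry (k : ℕ) (x : KW cs (k + 1) → R) :
    comparison cs k (bdry cs k x) = boundary (comparison cs (k + 1) x) := by
  have hsum (τ : Finset (Fin 9)) : boundary (comparison cs (k + 1) x) τ =
      ∑ σ : KW cs (k + 1), simplexWeight σ * x σ * (incidence σ τ : R) := by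
    classical
    rw [boundary, MorseData.act_apply,
      ← Finset.sum_filter_add_sum_filter_not Finset.univ
        (fun σ : Finset (Fin 9) => σ.card = k + 1 ∧ (parabolic cs σ : Set W).Finite),
      Finset.sum_eq_zero (s := Finset.univ.filter fun σ : Finset (Fin 9) =>
        ¬ (σ.card = k + 1 ∧ (parabolic cs σ : Set W).Finite)), add_zero,
      Finset.sum_subtype (F := inferInstance) (p := fun σ : Finset (Fin 9) =>
        σ.card = k + 1 ∧ (parabolic cs σ : Set W).Finite) _ (by simp)]
    · exact Finset.sum_congr rfl fun σ _ => by rw [comparison_apply]; rfl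
    · intro σ hσ
      rw [comparison_apply_of_not cs x (Finset.mem_filter.1 hσ).2, zero_mul]
  ext τ : 1
  rw [hsum]
  by_cases h : τ.card = k ∧ (parabolic cs τ : Set W).Finite
  · have := comparison_apply cs (bdry cs k x) ⟨τ, h⟩
    simp only at this
    rw [this, bdry, Matrix.mulVecLin_apply, Matrix.mulVec, dotProduct, Finset.mul_sum]
    refine Finset.sum_congr rfl fun σ _ => ?_
    rw [Matrix.of_apply, ← mul_assoc, simplexWeight_mul_bcoeff hM σ.2.2]
    ring
  · rw [comparison_apply_of_not cs _ h]
    refine (Finset.sum_eq_zero fun σ _ => ?_).symm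
    by_cases h0 : incidence σ τ = 0
    · rw [h0, Int.cast_zero, mul_zero]
    · obtain ⟨s, hs, rfl⟩ := incidence_ne_zero h0
      exact absurd ⟨by rw [Finset.card_erase_of_mem hs, σ.2.1, Nat.add_sub_cancel],
        finite_erase hM s⟩ h

lemma exists_comparison_eq {k : ℕ} (hk : k < 9) {u : Finset (Fin 9) → R}
    (hu : u ∈ simplexChains k) : ∃ x, comparison cs k x = u := by
  choose c hc using fun σ => (hu σ).1
  refine ⟨fun σ => c σ, funext fun σ => ?_⟩
  by_cases h : σ.card = k
  · have hf : (parabolic cs σ : Set W).Finite := by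
      rw [finite_iff hM]
      rintro rfl
      simp at h
      omega
    rw [comparison_apply cs _ ⟨σ, h, hf⟩, hc]
  · rw [comparison_apply_of_not cs _ fun h' => h h'.1, (hu σ).2 h]

lemma mem_cycles_iff {k : ℕ} (x : KW cs k → R) :
    x ∈ cycles cs k ↔ boundary (comparison cs k x) = 0 := by
  cases k with
  | zero =>
    refine iff_of_true trivial (funext fun τ => ?_)
    rw [boundary, MorseData.act_apply, Pi.zero_apply]
    refine Finset.sum_eq_zero fun σ _ => ?_
    by_cases h0 : incidence σ τ = 0
    · simp [h0]
    · obtain ⟨s, hs, -⟩ := incidence_ne_zero h0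
      rw [comparison_apply_of_not, zero_mul]
      exact fun h => by simp [Finset.card_eq_zero.1 h.1] at hs
  | succ k =>
    rw [cycles, LinearMap.mem_ker, ← comparison_bdry hM,
      map_eq_zero_iff _ (comparison_injective cs k)]

/-- The comparison map on cycles. -/
noncomputable def comparisonCycles (k : ℕ) :
    cycles cs k →ₗ[R] zChains (Matrix.of incidence) Finset.card simplexWeight k :=
  LinearMap.restrict (comparison cs k) fun x hx =>
    ⟨comparison_mem cs k x, (mem_cycles_iff hM x).1 hx⟩

lemma comparisonCycles_surjective {k : ℕ} (hk : k < 9) :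
    Function.Surjective (comparisonCycles (cs := cs) hM k) := by
  rintro ⟨u, hu, hu0⟩
  obtain ⟨x, rfl⟩ := exists_comparison_eq (cs := cs) hM hk hu
  exact ⟨⟨x, (mem_cycles_iff hM x).2 hu0⟩, rfl⟩

lemma homology_equiv {k : ℕ} (hk : k < 8) :
    Nonempty (Hgy cs k ≃ₗ[R] (∀ i : Fin (barList k).length, CycQuot (barList k)[i].1)) := by
  obtain ⟨θ, hθ, hker⟩ := exists_surjective_cycQuot (k := k) (by omega)
  have hk9 : k < 9 := by omega
  refine ⟨Submodule.quotEquivOfEq _ _ ?_ ≪≫ₗ LinearMap.quotKerEquivOfSurjective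
    (θ ∘ₗ comparisonCycles hM k) (hθ.comp (comparisonCycles_surjective hM hk9))⟩
  ext x
  rw [LinearMap.mem_ker, LinearMap.comp_apply, hker, Submodule.mem_comap, LinearMap.mem_range]
  constructor
  · rintro ⟨y, hy⟩
    refine ⟨comparison cs (k + 1) y, comparison_mem cs _ y, ?_⟩
    rw [← comparison_bdry hM, hy]
    rfl
  · rintro ⟨u, hu, hux⟩
    obtain ⟨y, rfl⟩ := exists_comparison_eq (cs := cs) hM (by omega) hu
    refine ⟨y, comparison_injective cs k ?_⟩
    rw [comparison_bdry hM, hux]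
    rfl

lemma isEmpty_KW {k : ℕ} (hk : 9 ≤ k) : IsEmpty (KW cs k) := by
  refine ⟨fun σ => (finite_iff hM).1 σ.2.2 ?_⟩
  rw [← Finset.card_eq_iff_eq_univ]
  have h1 := Finset.card_le_univ σ.1
  rw [Fintype.card_fin] at h1 ⊢
  have := σ.2.1
  omega

lemma homology_subsingleton {k : ℕ} (hk : 9 ≤ k) : Subsingleton (Hgy cs k) := by
  have := isEmpty_KW (cs := cs) hM hk
  have : Subsingleton (cycles cs k) := inferInstance
  exact (Submodule.mkQ_surjective _).subsingleton

lemma homology_top : Nonempty (Hgy cs 8 ≃ₗ[R] R) := by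
  have := isEmpty_KW (cs := cs) (k := 9) hM le_rfl
  have hbot : Submodule.comap (cycles cs 8).subtype (LinearMap.range (bdry cs 8)) = ⊥ := by
    rw [Submodule.eq_bot_iff]
    rintro x ⟨y, hy⟩
    rw [Subsingleton.elim y 0, map_zero] at hy
    exact Subtype.ext hy.symm
  set e : Finset (Fin 9) → R := Pi.single Finset.univ (simplexWeight Finset.univ) with he
  have hmem : e ∈ simplexChains 9 := by
    intro σ
    by_cases h : σ = Finset.univ
    · subst h
      exact ⟨by rw [he, Pi.single_eq_same], by simp⟩
    · rw [he, Pi.single_eq_of_ne h]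
      exact ⟨dvd_zero _, fun _ => rfl⟩
  have hspan : ∀ u ∈ simplexChains 9, ∃ r : R, r • e = u := by
    intro u hu
    obtain ⟨r, hr⟩ := (hu Finset.univ).1
    refine ⟨r, funext fun σ => ?_⟩
    by_cases h : σ = Finset.univ
    · subst h
      rw [Pi.smul_apply, he, Pi.single_eq_same, hr, smul_eq_mul, mul_comm]
    · rw [Pi.smul_apply, he, Pi.single_eq_of_ne h, smul_zero, (hu σ).2]
      exact fun h' => h ((Finset.card_eq_iff_eq_univ σ).1 (by rw [h', Fintype.card_fin]))
  have hz : boundary e ∈ zChains (Matrix.of incidence) Finset.card simplexWeight 8 := by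
    refine ⟨boundary_mem hmem, LinearMap.mem_ker.2 ?_⟩
    rw [boundary, MorseData.act_act, incidence_mul_incidence,
      MorseData.act_zero]
  obtain ⟨z, hz⟩ := comparisonCycles_surjective (cs := cs) hM (by norm_num) ⟨_, hz⟩
  have hz' : comparison cs 8 z = boundary e := congrArg Subtype.val hz
  have hinj : Function.Injective (LinearMap.toSpanSingleton R (cycles cs 8) z) := by
    rw [injective_iff_map_eq_zero]
    intro r hr
    have h1 : r • boundary e = 0 := by
      rw [← hz', ← map_smul]
      have : r • (z : KW cs 8 → R) = 0 := congrArg Subtype.val hr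
      rw [this, map_zero]
    have h2 := congrFun h1 (Finset.univ.erase 0)
    rw [Pi.smul_apply, boundary, MorseData.act_apply, Finset.sum_eq_single Finset.univ
      (fun σ _ h => by rw [he, Pi.single_eq_of_ne h, zero_mul]) (by simp), he,
      Pi.single_eq_same, Matrix.of_apply, incidence_erase (Finset.mem_univ _)] at h2
    simpa [simplexWeight_ne_zero] using h2
  have hsurj : Function.Surjective (LinearMap.toSpanSingleton R (cycles cs 8) z) := by
    intro x
    obtain ⟨θ, -, hker⟩ := exists_surjective_cycQuot (k := 8) (by norm_num)
    have : IsEmpty (Fin (barList 8).length) := Fin.isEmpty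
    obtain ⟨u, hu, hux⟩ := (hker (comparisonCycles hM 8 x)).1 (Subsingleton.elim _ _)
    obtain ⟨r, rfl⟩ := hspan u hu
    refine ⟨r, Subtype.ext (comparison_injective cs 8 ?_)⟩
    rw [LinearMap.toSpanSingleton_apply, Submodule.coe_smul, map_smul, hz', ← map_smul, hux]
    rfl
  exact ⟨Submodule.quotEquivOfEqBot _ hbot ≪≫ₗ (LinearEquiv.ofBijective _ ⟨hinj, hsurj⟩).symm⟩

end Weighted

/-- A product with one factor. -/
noncomputable def piOne (f : Fin 1 → ℕ) : (∀ i, CycQuot (f i)) ≃ₗ[R] CycQuot (f 0) :=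
  LinearEquiv.piUnique R fun i => CycQuot (f i)

/-- Splitting off the first factor of a product. -/
noncomputable def piSucc {n : ℕ} (f : Fin (n + 1) → ℕ) {N : Type*} [AddCommGroup N] [Module R N]
    (e : (∀ i : Fin n, CycQuot (Fin.tail f i)) ≃ₗ[R] N) :
    (∀ i, CycQuot (f i)) ≃ₗ[R] CycQuot (f 0) × N :=
  (Fin.consLinearEquiv R fun i => CycQuot (f i)).symm ≪≫ₗ
    LinearEquiv.prodCongr (LinearEquiv.refl _ _) e

end AffineE8

/-- Homology of the weighted complex for the affine Coxeter system of type `Ẽ₈` (generators indexed by `0,…,8`). -/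
theorem homology_affine_E8 {W : Type*} [Group W] {Mat : CoxeterMatrix (Fin 9)}
    (cs : CoxeterSystem Mat W)
    (hM : ∀ i j : Fin 9, i.val < j.val →
      Mat.M i j = (if (i.val, j.val) ∈ ([(0, 8), (1, 3), (2, 4), (3, 4), (4, 5), (5, 6), (6, 7), (7, 8)] : List (ℕ × ℕ)) then 3 else 2)) :
    Nonempty (Hgy cs 0 ≃ₗ[R] (CycQuot 2)) ∧
    Subsingleton (Hgy cs 1) ∧
    Subsingleton (Hgy cs 2) ∧
    Subsingleton (Hgy cs 3) ∧
    Nonempty (Hgy cs 4 ≃ₗ[R] (CycQuot 4)) ∧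
    Subsingleton (Hgy cs 5) ∧
    Nonempty (Hgy cs 6 ≃ₗ[R] (CycQuot 5 × CycQuot 8)) ∧
    Nonempty (Hgy cs 7 ≃ₗ[R] (CycQuot 2 × CycQuot 2 × CycQuot 3 × CycQuot 4 × CycQuot 5 × CycQuot 8 × CycQuot 9 × CycQuot 14)) ∧
    Nonempty (Hgy cs 8 ≃ₗ[R] R) ∧
    (∀ k, 9 ≤ k → Subsingleton (Hgy cs k)) := by
  have hzero {k : ℕ} (hk : k < 8) (h : AffineE8.barList k = []) : Subsingleton (Hgy cs k) := by
    obtain ⟨e⟩ := AffineE8.homology_equiv (cs := cs) hM hk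
    have : IsEmpty (Fin (AffineE8.barList k).length) := by rw [h]; exact Fin.isEmpty
    exact e.toEquiv.subsingleton
  obtain ⟨e0⟩ := AffineE8.homology_equiv (cs := cs) (k := 0) hM (by norm_num)
  obtain ⟨e4⟩ := AffineE8.homology_equiv (cs := cs) (k := 4) hM (by norm_num)
  obtain ⟨e6⟩ := AffineE8.homology_equiv (cs := cs) (k := 6) hM (by norm_num)
  obtain ⟨e7⟩ := AffineE8.homology_equiv (cs := cs) (k := 7) hM (by norm_num)
  refine ⟨⟨e0 ≪≫ₗ AffineE8.piOne fun i => (AffineE8.barList 0)[i].1⟩, hzero (by norm_num) rfl,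
    hzero (by norm_num) rfl, hzero (by norm_num) rfl,
    ⟨e4 ≪≫ₗ AffineE8.piOne fun i => (AffineE8.barList 4)[i].1⟩, hzero (by norm_num) rfl,
    ⟨e6 ≪≫ₗ AffineE8.piSucc (fun i => (AffineE8.barList 6)[i].1) (AffineE8.piOne _)⟩,
    ⟨e7 ≪≫ₗ AffineE8.piSucc (fun i => (AffineE8.barList 7)[i].1) (AffineE8.piSucc _
      (AffineE8.piSucc _ (AffineE8.piSucc _ (AffineE8.piSucc _ (AffineE8.piSucc _
        (AffineE8.piSucc _ (AffineE8.piOne _)))))))⟩,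
    AffineE8.homology_top hM, fun k hk => AffineE8.homology_subsingleton hM hk⟩
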